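/- arXiv:2602.06817 — 4 statements merged into one kernel-verified Lean document; each statement's English description precedes it below -/
import Mathlib

section
/- Let K be a field and I ⊆ K[X₁,…,Xₙ] a zero-dimensional ideal with finite variety V(I) (over an algebraic closure), and let p ∈ K[X₁,…,Xₙ]. Then the trace of the multiplication-by-p endomorphism on the finite-dimensional quotient algebra K[X₁,…,Xₙ]/I equals the sum over x ∈ V(I) of μ(x)·p(x), where μ(x) is the multiplicity (local dimension) of x. -/
open MvPolynomial

/-- The local multiplicity `μ(x)` of a point `x ∈ K̄ⁿ` with respect to an ideal
`I ⊆ K[X₁,…,Xₙ]`: the dimension over `K̄` of the localization of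
`K̄[X₁,…,Xₙ]/I·K̄[X₁,…,Xₙ]` at the maximal ideal corresponding to `x`. -/
noncomputable def localMultiplicity (K : Type*) [Field K] (n : ℕ)
    (I : Ideal (MvPolynomial (Fin n) K)) (x : Fin n → AlgebraicClosure K) : ℕ :=
  letI Kbar := AlgebraicClosure K
  letI R := MvPolynomial (Fin n) Kbar
  letI Ibar : Ideal R := I.map (MvPolynomial.map (algebraMap K Kbar))
  letI mx : Ideal R := RingHom.ker (MvPolynomial.eval x)
  haveI : mx.IsPrime := RingHom.ker_isPrime _
  letI : Algebra Kbar (Localization.AtPrime mx) :=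
    ((algebraMap R (Localization.AtPrime mx)).comp (algebraMap Kbar R)).toAlgebra
  Module.finrank Kbar
    ((Localization.AtPrime mx) ⧸ Ibar.map (algebraMap R (Localization.AtPrime mx)))

namespace StickelbergerAux

open TensorProduct

lemma trace_pi {F ι : Type*} [Field F] [Fintype ι] (S : ι → Type*) [∀ i, CommRing (S i)]
    [∀ i, Algebra F (S i)] [∀ i, Module.Finite F (S i)] (a : Π i, S i) :
    Algebra.trace F (Π i, S i) a = ∑ i, Algebra.trace F (S i) (a i) := by
  classical
  rw [Algebra.trace_eq_matrix_trace (Pi.basis fun i => Module.finBasis F (S i))]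
  simp_rw [fun i => Algebra.trace_eq_matrix_trace (Module.finBasis F (S i)) (a i)]
  simp only [Matrix.trace, Matrix.diag, Fintype.sum_sigma, Algebra.leftMulMatrix_eq_repr_mul,
    Pi.basis_repr, Pi.basis_apply, Pi.mul_apply, Pi.single_eq_same]

lemma trace_local {F S : Type*} [Field F] [CommRing S] [Algebra F S] [Module.Finite F S]
    [IsLocalRing S] (s : S) (c : F) (h : s - algebraMap F S c ∈ IsLocalRing.maximalIdeal S) :
    Algebra.trace F S s = (Module.finrank F S : F) * c := by
  have : IsArtinianRing S := IsArtinianRing.of_finite F S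
  have hn : IsNilpotent (s - algebraMap F S c) := by
    rwa [← mem_nilradical, Ring.KrullDimLE.nilradical_eq_maximalIdeal]
  have h0 := (Algebra.isNilpotent_trace_of_isNilpotent (R := F) hn).eq_zero
  rw [map_sub, Algebra.trace_algebraMap, sub_eq_zero] at h0
  rw [h0, nsmul_eq_mul]

lemma finite_loc {F B : Type*} [Field F] [CommRing B] [Algebra F B] [Module.Finite F B]
    (P : Ideal B) [P.IsPrime] : Module.Finite F (Localization.AtPrime P) :=
  have : IsArtinianRing B := IsArtinianRing.of_finite F B
  Module.Finite.of_surjective (Algebra.algHom F B (Localization.AtPrime P)).toLinearMap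
      (IsArtinianRing.localization_surjective P.primeCompl (Localization.AtPrime P))

lemma trace_sum {F B : Type*} [Field F] [CommRing B] [Algebra F B] [Module.Finite F B]
    [Fintype (PrimeSpectrum B)] (b : B) :
    Algebra.trace F B b = ∑ P : PrimeSpectrum B,
      Algebra.trace F (Localization.AtPrime P.asIdeal) (algebraMap B _ b) := by
  have : IsArtinianRing B := IsArtinianRing.of_finite F B
  have (P : Ideal B) [P.IsPrime] := finite_loc (F := F) P
  rw [← Algebra.trace_eq_of_algEquiv ((PrimeSpectrum.toPiLocalizationEquiv B).restrictScalars F)]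
  exact trace_pi (fun P : PrimeSpectrum B => Localization.AtPrime P.asIdeal) _

lemma finrank_loc {F R : Type*} [Field F] [CommRing R] [Algebra F R] (J m : Ideal R) [m.IsPrime]
    (P : Ideal (R ⧸ J)) [P.IsPrime] (h : P.comap (Ideal.Quotient.mk J) = m)
    (S : Type*) [CommRing S] [Algebra R S] [IsLocalization.AtPrime S m] [Algebra F S]
    (hS : ∀ c, algebraMap F S c = algebraMap R S (algebraMap F R c)) :
    Module.finrank F (S ⧸ J.map (algebraMap R S)) =
      Module.finrank F (Localization.AtPrime P) := by
  have hM : Algebra.algebraMapSubmonoid (R ⧸ J) m.primeCompl = P.primeCompl := by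
    ext b
    obtain ⟨r, rfl⟩ := Ideal.Quotient.mk_surjective b
    subst h
    constructor
    · rintro ⟨s, hs, hs'⟩
      rw [← hs']
      exact hs
    · intro hr
      exact ⟨r, hr, rfl⟩
  have h1 : IsLocalization (Algebra.algebraMapSubmonoid (R ⧸ J) m.primeCompl)
    (S ⧸ J.map (algebraMap R S)) := inferInstance
  rw [hM] at h1
  let e := IsLocalization.algEquiv P.primeCompl (S ⧸ J.map (algebraMap R S))
    (Localization.AtPrime P)
  have he : ∀ c : F, e.toRingEquiv (algebraMap F _ c) = algebraMap F _ c := by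
    intro c
    have h2 : algebraMap F (S ⧸ J.map (algebraMap R S)) c =
        algebraMap (R ⧸ J) _ (algebraMap F (R ⧸ J) c) := by
      change Ideal.Quotient.mk _ (algebraMap F S c) =
        Ideal.Quotient.mk _ (algebraMap R S (algebraMap F R c))
      rw [hS]
    rw [h2, IsScalarTower.algebraMap_apply F (R ⧸ J) (Localization.AtPrime P)]
    exact e.commutes _
  exact (AlgEquiv.ofRingEquiv he).toLinearEquiv.finrank_eq

lemma localMultiplicity_eq (K : Type*) [Field K] (n : ℕ)
    (I : Ideal (MvPolynomial (Fin n) K)) (x : Fin n → AlgebraicClosure K)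
    (P : Ideal (MvPolynomial (Fin n) (AlgebraicClosure K) ⧸
      I.map (MvPolynomial.map (algebraMap K (AlgebraicClosure K))))) [P.IsPrime]
    (h : P.comap (Ideal.Quotient.mk _) = RingHom.ker (MvPolynomial.eval x)) :
    localMultiplicity K n I x =
      Module.finrank (AlgebraicClosure K) (Localization.AtPrime P) := by
  have : (RingHom.ker (MvPolynomial.eval x)).IsPrime := RingHom.ker_isPrime _
  have hS : ∀ c : AlgebraicClosure K,
      algebraMap _ (Localization.AtPrime (RingHom.ker (MvPolynomial.eval x))) c =
      algebraMap (MvPolynomial (Fin n) (AlgebraicClosure K)) _ (algebraMap _ _ c) :=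
    fun c => IsScalarTower.algebraMap_apply _ _ _ c
  have key := finrank_loc _ _ P h (Localization.AtPrime (RingHom.ker (MvPolynomial.eval x))) hS
  rw [← key]
  unfold localMultiplicity
  rfl

/-- Base change of the quotient algebra. -/
noncomputable def baseChangeEquiv (K L : Type*) [Field K] [Field L] [Algebra K L] (n : ℕ)
    (I : Ideal (MvPolynomial (Fin n) K)) :
    L ⊗[K] (MvPolynomial (Fin n) K ⧸ I) ≃ₐ[L]
      MvPolynomial (Fin n) L ⧸ I.map (MvPolynomial.map (algebraMap K L)) :=
  (Algebra.TensorProduct.tensorQuotientEquiv (R := K) L (MvPolynomial (Fin n) K) L I).trans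
    (Ideal.quotientEquivAlg _ _ (MvPolynomial.algebraTensorAlgEquiv K L) (by
      have h := Ideal.map_map (I := I)
        (Algebra.TensorProduct.includeRight : MvPolynomial (Fin n) K →ₐ[K] _).toRingHom
        (MvPolynomial.algebraTensorAlgEquiv (σ := Fin n) K L :
          L ⊗[K] MvPolynomial (Fin n) K →+* MvPolynomial (Fin n) L)
      refine Eq.trans ?_ h.symm
      congr 1
      refine RingHom.ext fun f => ?_
      simp))

lemma baseChangeEquiv_tmul (K L : Type*) [Field K] [Field L] [Algebra K L] (n : ℕ)
    (I : Ideal (MvPolynomial (Fin n) K)) (p : MvPolynomial (Fin n) K) :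
    baseChangeEquiv K L n I (1 ⊗ₜ Ideal.Quotient.mk I p) =
      Ideal.Quotient.mk _ (MvPolynomial.map (algebraMap K L) p) := by
  have : baseChangeEquiv K L n I (1 ⊗ₜ Ideal.Quotient.mk I p) =
      Ideal.Quotient.mk _ (MvPolynomial.algebraTensorAlgEquiv K L (1 ⊗ₜ p)) := rfl
  rw [this]
  simp

lemma trace_tensor (K L A : Type*) [Field K] [Field L] [Algebra K L] [CommRing A] [Algebra K A]
    [Module.Finite K A] (a : A) :
    algebraMap K L (LinearMap.trace K A (LinearMap.mulLeft K a)) =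
      Algebra.trace L (L ⊗[K] A) ((1 : L) ⊗ₜ[K] a) := by
  rw [← LinearMap.trace_baseChange, Algebra.trace_apply]
  congr 1
  ext q
  simp

lemma trace_baseChange (K L : Type*) [Field K] [Field L] [Algebra K L] (n : ℕ)
    (I : Ideal (MvPolynomial (Fin n) K)) [FiniteDimensional K (MvPolynomial (Fin n) K ⧸ I)]
    (p : MvPolynomial (Fin n) K) :
    algebraMap K L (LinearMap.trace K (MvPolynomial (Fin n) K ⧸ I)
          (LinearMap.mulLeft K (Ideal.Quotient.mk I p))) =
    Algebra.trace L (MvPolynomial (Fin n) L ⧸ I.map (MvPolynomial.map (algebraMap K L)))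
      (Ideal.Quotient.mk _ (MvPolynomial.map (algebraMap K L) p)) := by
  rw [← baseChangeEquiv_tmul]
  have h1 := Algebra.trace_eq_of_algEquiv (A := L) (B := L ⊗[K] (MvPolynomial (Fin n) K ⧸ I))
    (C := MvPolynomial (Fin n) L ⧸ I.map (MvPolynomial.map (algebraMap K L)))
    (baseChangeEquiv K L n I) ((1 : L) ⊗ₜ[K] Ideal.Quotient.mk I p)
  exact (trace_tensor K L _ _).trans h1.symm

end StickelbergerAux

/-- **Stickelberger's theorem, trace part**: for a zero-dimensional ideal
`I ⊆ K[X₁,…,Xₙ]` with finite variety `V(I)` over the algebraic closure, and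
`p ∈ K[X₁,…,Xₙ]`, the trace of the multiplication-by-`p` endomorphism of the
finite-dimensional quotient `K[X₁,…,Xₙ]/I` equals `∑_{x ∈ V(I)} μ(x)·p(x)`. -/
theorem stickelberger_trace
    (K : Type*) [Field K] [CharZero K] (n : ℕ)
    (I : Ideal (MvPolynomial (Fin n) K))
    [FiniteDimensional K (MvPolynomial (Fin n) K ⧸ I)]
    (V : Set (Fin n → AlgebraicClosure K))
    (hV : V = {x | ∀ f ∈ I, MvPolynomial.aeval x f = 0})
    (hVfin : V.Finite)
    (p : MvPolynomial (Fin n) K) :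
    algebraMap K (AlgebraicClosure K)
        (LinearMap.trace K (MvPolynomial (Fin n) K ⧸ I)
          (LinearMap.mulLeft K (Ideal.Quotient.mk I p)))
      = ∑ x ∈ hVfin.toFinset, (localMultiplicity K n I x : AlgebraicClosure K) *
          MvPolynomial.aeval x p := by
  classical
  rw [StickelbergerAux.trace_baseChange K (AlgebraicClosure K) n I p]
  set J : Ideal (MvPolynomial (Fin n) (AlgebraicClosure K)) := I.map (MvPolynomial.map (algebraMap K (AlgebraicClosure K))) with hJ
  have : Module.Finite (AlgebraicClosure K) (MvPolynomial (Fin n) (AlgebraicClosure K) ⧸ J) :=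
    Module.Finite.equiv (StickelbergerAux.baseChangeEquiv K (AlgebraicClosure K) n I).toLinearEquiv
  have : IsArtinianRing (MvPolynomial (Fin n) (AlgebraicClosure K) ⧸ J) := IsArtinianRing.of_finite (AlgebraicClosure K) _
  let : Fintype (PrimeSpectrum (MvPolynomial (Fin n) (AlgebraicClosure K) ⧸ J)) := Fintype.ofFinite _
  rw [StickelbergerAux.trace_sum]
  have hpt : ∀ x ∈ V, ∀ f ∈ J, MvPolynomial.eval x f = 0 := by
    intro x hx
    have : J ≤ RingHom.ker (MvPolynomial.eval x) := by
      rw [hJ, Ideal.map_le_iff_le_comap]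
      intro f hf
      rw [hV] at hx
      have := hx f hf
      rw [Ideal.mem_comap, RingHom.mem_ker, MvPolynomial.eval_map]
      exact this
    exact fun f hf => this hf
  have hmem : ∀ x (hx : x ∈ hVfin.toFinset), x ∈ V := fun x hx => by simpa using hx
  let φ : ∀ x ∈ V, (MvPolynomial (Fin n) (AlgebraicClosure K) ⧸ J) →+* (AlgebraicClosure K) := fun x hx =>
    Ideal.Quotient.lift J (MvPolynomial.eval x) (hpt x hx)
  have hcomap : ∀ x (hx : x ∈ V), (RingHom.ker (φ x hx)).comap (Ideal.Quotient.mk J) =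
      RingHom.ker (MvPolynomial.eval x) := fun x hx => by
    ext f
    simp [φ]
  symm
  refine Finset.sum_bij (fun x hx => ⟨RingHom.ker (φ x (hmem x hx)), RingHom.ker_isPrime _⟩)
    (fun _ _ => Finset.mem_univ _) ?_ ?_ ?_
  · intro x hx y hy hxy
    have h1 : RingHom.ker (φ x (hmem x hx)) = RingHom.ker (φ y (hmem y hy)) :=
      congrArg PrimeSpectrum.asIdeal hxy
    have h2 : RingHom.ker (MvPolynomial.eval x) = RingHom.ker (MvPolynomial.eval y) := by
      rw [← hcomap x (hmem x hx), ← hcomap y (hmem y hy), h1]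
    funext i
    have h3 : (X i - C (x i) : MvPolynomial (Fin n) (AlgebraicClosure K)) ∈ RingHom.ker (MvPolynomial.eval x) := by
      simp [RingHom.mem_ker]
    rw [h2, RingHom.mem_ker] at h3
    simp only [map_sub, eval_X, eval_C, sub_eq_zero] at h3
    exact h3.symm
  · intro P _
    have : P.asIdeal.IsMaximal := Ideal.IsPrime.isMaximal' P.isPrime
    have hmax : (P.asIdeal.comap (Ideal.Quotient.mk J)).IsMaximal :=
      Ideal.comap_isMaximal_of_surjective _ Ideal.Quotient.mk_surjective
    obtain ⟨x, hx⟩ := MvPolynomial.isMaximal_iff_eq_vanishingIdeal_singleton.mp hmax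
    have hx' : P.asIdeal.comap (Ideal.Quotient.mk J) = RingHom.ker (MvPolynomial.eval x) := by
      rw [hx]
      ext f
      simp [RingHom.mem_ker]
    have hxV : x ∈ V := by
      rw [hV]
      intro f hf
      have : MvPolynomial.map (algebraMap K (AlgebraicClosure K)) f ∈
          P.asIdeal.comap (Ideal.Quotient.mk J) := by
        rw [Ideal.mem_comap, Ideal.Quotient.eq_zero_iff_mem.mpr (Ideal.mem_map_of_mem _ hf)]
        exact zero_mem _
      rw [hx', RingHom.mem_ker, MvPolynomial.eval_map] at this
      exact this
    refine ⟨x, by simpa using hxV, ?_⟩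
    apply PrimeSpectrum.ext
    apply Ideal.comap_injective_of_surjective _ (Ideal.Quotient.mk_surjective (I := J))
    rw [hx']
    exact hcomap x hxV
  · intro x hx
    have : (RingHom.ker (φ x (hmem x hx))).IsPrime := RingHom.ker_isPrime _
    rw [StickelbergerAux.localMultiplicity_eq K n I x _ (hcomap x (hmem x hx))]
    have := StickelbergerAux.finite_loc (F := (AlgebraicClosure K)) (RingHom.ker (φ x (hmem x hx)))
    symm
    refine StickelbergerAux.trace_local _ _ ?_
    rw [IsScalarTower.algebraMap_apply (AlgebraicClosure K) (MvPolynomial (Fin n) (AlgebraicClosure K) ⧸ J), ← map_sub]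
    refine (IsLocalization.AtPrime.to_map_mem_maximal_iff _
      (RingHom.ker (φ x (hmem x hx))) _).mpr ?_
    rw [RingHom.mem_ker, map_sub]
    have h1 : φ x (hmem x hx) (Ideal.Quotient.mk J (MvPolynomial.map (algebraMap K (AlgebraicClosure K)) p)) =
        MvPolynomial.aeval x p := by
      simp only [φ, Ideal.Quotient.lift_mk, MvPolynomial.eval_map]
      rfl
    have h2 : φ x (hmem x hx) (algebraMap (AlgebraicClosure K) _ (MvPolynomial.aeval x p)) =
        MvPolynomial.aeval x p := by
      change φ x (hmem x hx) (Ideal.Quotient.mk J (C (MvPolynomial.aeval x p))) = _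
      simp only [φ, Ideal.Quotient.lift_mk, MvPolynomial.eval_C]
    rw [h1, h2, sub_self]
end

section
/- Let K be a field, I ⊆ K[X₁,…,Xₙ] a zero-dimensional ideal, and p ∈ K[X₁,…,Xₙ]. Then the characteristic polynomial of the multiplication-by-p endomorphism on K[X₁,…,Xₙ]/I equals ∏_{x ∈ V(I)} (T − p(x))^{μ(x)}, where the product is over points of V(I) in the algebraic closure counted with multiplicity μ(x). -/
open MvPolynomial

theorem charpoly_piMap_aux {F : Type*} [Field F] {ι : Type*} [Fintype ι]
    (M : ι → Type*) [∀ i, AddCommGroup (M i)] [∀ i, Module F (M i)] [∀ i, Module.Finite F (M i)]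
    (f : ∀ i, M i →ₗ[F] M i) (g : (∀ i, M i) →ₗ[F] (∀ i, M i))
    (hg : ∀ v i, g v i = f i (v i)) :
    g.charpoly = ∏ i, (f i).charpoly := by
  classical
  let : LinearOrder ι := IsWellOrder.linearOrder (WellOrderingRel (α := ι))
  let b := fun i => Module.Free.chooseBasis F (M i)
  have hmat : ∀ (i j : Σ i, Module.Free.ChooseBasisIndex F (M i)), 
      LinearMap.toMatrix (Pi.basis b) (Pi.basis b) g i j =
        (b i.1).repr (f i.1 ((Pi.basis b j) i.1)) i.2 := by
    intro i j
    rw [LinearMap.toMatrix_apply, Pi.basis_repr, hg]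
  have hbt : (LinearMap.toMatrix (Pi.basis b) (Pi.basis b) g).BlockTriangular Sigma.fst := by
    intro i j hij
    rw [hmat, Pi.basis_apply, Pi.single_eq_of_ne (ne_of_gt hij)]
    simp
  rw [← LinearMap.charpoly_toMatrix g (Pi.basis b), Matrix.charpoly,
    Matrix.BlockTriangular.det_fintype hbt.charmatrix]
  refine Finset.prod_congr rfl fun k _ => ?_
  rw [← LinearMap.charpoly_toMatrix (f k) (b k), Matrix.charpoly,
    ← Matrix.det_reindex_self (Equiv.sigmaSubtype k)]
  congr 1
  ext i j : 2
  rw [Matrix.reindex_apply, Matrix.submatrix_apply, Matrix.toSquareBlock_def, Matrix.of_apply]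
  simp only [Matrix.charmatrix_apply, hmat, Equiv.sigmaSubtype, Equiv.coe_fn_symm_mk, Pi.basis_apply, LinearMap.toMatrix_apply, Pi.single_eq_same]
  congr 1
  simp only [Matrix.diagonal_apply]
  simp

theorem lemA {F B : Type*} [Field F] [CommRing B] [Algebra F B] [Module.Finite F B]
    [Fintype (MaximalSpectrum B)]
    (b : B) (c : MaximalSpectrum B → F) (hc : ∀ m : MaximalSpectrum B, b - algebraMap F B (c m) ∈ m.asIdeal) :
    (LinearMap.mulLeft F b).charpoly = 
    ∏ m : MaximalSpectrum B, (Polynomial.X - Polynomial.C (c m)) ^ 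
      Module.finrank F (Localization.AtPrime m.asIdeal) := by
  have : IsArtinianRing B := .of_finite F B
  have (p : Ideal B) [p.IsPrime] : Module.Finite F (Localization.AtPrime p) :=
    Module.Finite.of_surjective (Algebra.algHom F B (Localization.AtPrime p)).toLinearMap
      (IsArtinianRing.localization_surjective p.primeCompl (Localization.AtPrime p))
  let e := ((MaximalSpectrum.toPiLocalizationEquiv B).restrictScalars F).toLinearEquiv
  rw [← LinearEquiv.charpoly_conj e]
  rw [charpoly_piMap_aux (fun m : MaximalSpectrum B => Localization.AtPrime m.asIdeal)
    (fun m => LinearMap.mulLeft F (algebraMap B _ b))]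
  · refine Finset.prod_congr rfl fun m _ => ?_
    set L := Localization.AtPrime m.asIdeal
    have : IsArtinianRing L := .of_finite F L
    have hn : IsNilpotent (algebraMap B L (b - algebraMap F B (c m))) := by
      have h : algebraMap B L (b - algebraMap F B (c m)) ∈ IsLocalRing.maximalIdeal L :=
        (IsLocalization.AtPrime.to_map_mem_maximal_iff L m.asIdeal _).2 (hc m)
      rw [← IsLocalRing.jacobson_eq_maximalIdeal ⊥ bot_ne_top] at h
      obtain ⟨k, hk⟩ := IsArtinianRing.isNilpotent_jacobson_bot (R := L)
      exact ⟨k, by simpa [hk] using Ideal.pow_mem_pow h k⟩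
    have hn2 : IsNilpotent (LinearMap.mulLeft F (algebraMap B L b) - (c m) • 1) := by
      have := hn.map (Algebra.lmul F L)
      have h5 : LinearMap.mulLeft F (algebraMap B L b) - (c m) • 1 =
          Algebra.lmul F L (algebraMap B L (b - algebraMap F B (c m))) := by
        ext x
        simp [← IsScalarTower.algebraMap_apply, Algebra.smul_def]
      rw [h5]
      exact this
    have h3 := hn2.charpoly_eq_X_pow_finrank
    rw [LinearMap.charpoly_sub_smul] at h3
    have h4 := congrArg (fun q => q.comp (Polynomial.X - Polynomial.C (c m))) h3
    simpa [Polynomial.comp_assoc] using h4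
  · intro v m
    obtain ⟨w, rfl⟩ := e.surjective v
    rw [LinearEquiv.conj_apply_apply, e.symm_apply_apply]
    exact map_mul (algebraMap B (Localization.AtPrime m.asIdeal)) _ _

theorem charpoly_mulLeft_equiv {F A B : Type*} [Field F] [CommRing A] [CommRing B]
    [Algebra F A] [Algebra F B] [Module.Finite F A] [Module.Finite F B] (e : A ≃ₐ[F] B) (a : A) :
    (LinearMap.mulLeft F a).charpoly = (LinearMap.mulLeft F (e a)).charpoly := by
  rw [← LinearEquiv.charpoly_conj e.toLinearEquiv]
  congr 1
  ext x
  simp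

open TensorProduct in
theorem baseChange_mulLeft_aux {K A : Type*} [Field K] [CommRing A] [Algebra K A]
    (F : Type*) [Field F] [Algebra K F] (a : A) :
    (LinearMap.mulLeft K a).baseChange F = LinearMap.mulLeft F ((1 : F) ⊗ₜ[K] a) := by
  ext x
  simp

open TensorProduct in
theorem charpoly_baseChange_aux {K A F C : Type*} [Field K] [CommRing A] [Algebra K A]
    [Module.Finite K A] [Field F] [Algebra K F] [CommRing C] [Algebra F C] [Module.Finite F C]
    (e : F ⊗[K] A ≃ₐ[F] C) (a : A) :
    (LinearMap.mulLeft K a).charpoly.map (algebraMap K F) =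
      (LinearMap.mulLeft F (e (1 ⊗ₜ a))).charpoly := by
  rw [← LinearMap.charpoly_baseChange, baseChange_mulLeft_aux]
  exact charpoly_mulLeft_equiv e _

open TensorProduct in
theorem lemD {K : Type*} [Field K] {n : ℕ}
    (I : Ideal (MvPolynomial (Fin n) K))
    [FiniteDimensional K (MvPolynomial (Fin n) K ⧸ I)] (F : Type*) [Field F] [Algebra K F]
    (p : MvPolynomial (Fin n) K) :
    ∃ (_ : Module.Finite F (MvPolynomial (Fin n) F ⧸ I.map (MvPolynomial.map (algebraMap K F)))),
    (LinearMap.charpoly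
        (LinearMap.mulLeft K (Ideal.Quotient.mk I p))).map (algebraMap K F)
    = (LinearMap.mulLeft F (Ideal.Quotient.mk (I.map (MvPolynomial.map (algebraMap K F))) 
        (MvPolynomial.map (algebraMap K F) p))).charpoly := by
  let e1 := Algebra.TensorProduct.tensorQuotientEquiv (R := K) F (MvPolynomial (Fin n) K) F I
  have hI : I.map (MvPolynomial.map (algebraMap K F)) = 
    (I.map (Algebra.TensorProduct.includeRight (A := F) (R := K))).map 
      (MvPolynomial.algebraTensorAlgEquiv (σ := Fin n) K F : _ →+* _) := by
    rw [← Ideal.map_coe (Algebra.TensorProduct.includeRight (A := F) (R := K)), Ideal.map_map]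
    congr 1
    refine RingHom.ext fun q => ?_
    simp
  let e2 := Ideal.quotientEquivAlg _ _ (MvPolynomial.algebraTensorAlgEquiv (σ := Fin n) K F) hI
  let e := (e1.trans e2)
  have : Module.Finite F (MvPolynomial (Fin n) F ⧸ I.map (MvPolynomial.map (algebraMap K F))) :=
    Module.Finite.equiv e.toLinearEquiv
  have h1 : Ideal.Quotient.mk (I.map (MvPolynomial.map (algebraMap K F)))
        (MvPolynomial.map (algebraMap K F) p) = e (1 ⊗ₜ Ideal.Quotient.mk I p) := by
    have : e1 (1 ⊗ₜ Ideal.Quotient.mk I p) = Ideal.Quotient.mk _ (1 ⊗ₜ p) := rfl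
    simp [e, this, e2]
  refine ⟨this, ?_⟩
  rw [h1]
  exact charpoly_baseChange_aux e _

theorem lemB {F R S : Type*} [Field F] [CommRing R] [Algebra F R] (J m : Ideal R) [m.IsPrime]
    [CommRing S] [Algebra R S] [IsLocalization.AtPrime S m] [Algebra F S] [IsScalarTower F R S]
    (mB : Ideal (R ⧸ J)) [mB.IsPrime] (h : mB.comap (Ideal.Quotient.mk J) = m) :
    Module.finrank F (Localization.AtPrime mB) = Module.finrank F (S ⧸ J.map (algebraMap R S)) := by
  have h1 : Algebra.algebraMapSubmonoid (R ⧸ J) m.primeCompl = mB.primeCompl := by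
    ext x
    obtain ⟨x, rfl⟩ := Ideal.Quotient.mk_surjective x
    subst h
    constructor
    · rintro ⟨y, hy, hyx⟩
      have hyx' : Ideal.Quotient.mk J y = Ideal.Quotient.mk J x := hyx
      rw [← hyx']
      exact hy
    · intro hx
      exact ⟨x, hx, rfl⟩
  have h2 : IsLocalization mB.primeCompl (S ⧸ J.map (algebraMap R S)) := by
    rw [← h1]
    infer_instance
  let e := IsLocalization.algEquiv mB.primeCompl (Localization.AtPrime mB)
    (S ⧸ J.map (algebraMap R S))
  have : IsScalarTower F (R ⧸ J) (S ⧸ J.map (algebraMap R S)) := by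
    refine IsScalarTower.of_algebraMap_eq fun r => ?_
    change Ideal.Quotient.mk _ (algebraMap F S r) =
      Ideal.Quotient.mk _ (algebraMap R S (algebraMap F R r))
    rw [← IsScalarTower.algebraMap_apply]
  exact (e.restrictScalars F).toLinearEquiv.finrank_eq


theorem lemB2 (K : Type*) [Field K] (n : ℕ)
    (I : Ideal (MvPolynomial (Fin n) K)) (x : Fin n → AlgebraicClosure K)
    (mB : Ideal (MvPolynomial (Fin n) (AlgebraicClosure K) ⧸
      I.map (MvPolynomial.map (algebraMap K (AlgebraicClosure K))))) [mB.IsPrime]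
    (h : mB.comap (Ideal.Quotient.mk _) = RingHom.ker (MvPolynomial.eval x)) :
    Module.finrank (AlgebraicClosure K) (Localization.AtPrime mB) = localMultiplicity K n I x := by
  let mx : Ideal (MvPolynomial (Fin n) (AlgebraicClosure K)) := RingHom.ker (MvPolynomial.eval x)
  have : mx.IsPrime := RingHom.ker_isPrime _
  exact lemB (S := Localization.AtPrime mx) _ mx mB h

/-- **Stickelberger's theorem, characteristic polynomial part**: for a zero-dimensional
ideal `I ⊆ K[X₁,…,Xₙ]` with finite variety `V(I)` over the algebraic closure, and
`p ∈ K[X₁,…,Xₙ]`, the characteristic polynomial of the multiplication-by-`p` endomorphism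
of the finite-dimensional quotient `K[X₁,…,Xₙ]/I` equals
`∏_{x ∈ V(I)} (T − p(x))^{μ(x)}`. -/
theorem stickelberger_charpoly
    (K : Type*) [Field K] [CharZero K] (n : ℕ)
    (I : Ideal (MvPolynomial (Fin n) K))
    [FiniteDimensional K (MvPolynomial (Fin n) K ⧸ I)]
    (V : Set (Fin n → AlgebraicClosure K))
    (hV : V = {x | ∀ f ∈ I, MvPolynomial.aeval x f = 0})
    (hVfin : V.Finite)
    (p : MvPolynomial (Fin n) K) :
    (LinearMap.charpoly
        (LinearMap.mulLeft K (Ideal.Quotient.mk I p))).map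
          (algebraMap K (AlgebraicClosure K))
      = ∏ x ∈ hVfin.toFinset,
          (Polynomial.X - Polynomial.C (MvPolynomial.aeval x p)) ^ localMultiplicity K n I x := by
  subst hV
  obtain ⟨hfin, hD⟩ := lemD I (AlgebraicClosure K) p
  set J := I.map (MvPolynomial.map (algebraMap K (AlgebraicClosure K))) with hJ
  have : IsArtinianRing (MvPolynomial (Fin n) (AlgebraicClosure K) ⧸ J) :=
    .of_finite (AlgebraicClosure K) _
  have : Fintype (MaximalSpectrum (MvPolynomial (Fin n) (AlgebraicClosure K) ⧸ J)) :=
    Fintype.ofFinite _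
  have hpt : ∀ m : MaximalSpectrum (MvPolynomial (Fin n) (AlgebraicClosure K) ⧸ J),
      ∃ x : Fin n → AlgebraicClosure K,
        m.asIdeal.comap (Ideal.Quotient.mk J) = RingHom.ker (MvPolynomial.eval x) := by
    intro m
    have := m.isMaximal
    have hm : (m.asIdeal.comap (Ideal.Quotient.mk J)).IsMaximal :=
      Ideal.comap_isMaximal_of_surjective _ Ideal.Quotient.mk_surjective
    obtain ⟨x, hx⟩ := MvPolynomial.isMaximal_iff_eq_vanishingIdeal_singleton.1 hm
    refine ⟨x, ?_⟩
    rw [hx]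
    ext q
    rw [MvPolynomial.mem_vanishingIdeal_singleton_iff, RingHom.mem_ker, MvPolynomial.aeval_eq_eval]
  choose pt hpt using hpt
  have haev : ∀ (x : Fin n → AlgebraicClosure K) (f : MvPolynomial (Fin n) K),
      MvPolynomial.aeval x f =
        MvPolynomial.eval x (MvPolynomial.map (algebraMap K (AlgebraicClosure K)) f) := by
    intro x f
    rw [MvPolynomial.aeval_def, MvPolynomial.eval_map]
  rw [hD, lemA _ (fun m => MvPolynomial.aeval (pt m) p)]
  · refine Finset.prod_bij (fun m _ => pt m) ?_ ?_ ?_ ?_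
    · intro m _
      simp only [Set.Finite.mem_toFinset, Set.mem_ofPred_eq]
      intro f hf
      rw [haev, ← RingHom.mem_ker, ← hpt m, Ideal.mem_comap,
        Ideal.Quotient.eq_zero_iff_mem.2 (Ideal.mem_map_of_mem _ hf)]
      exact zero_mem _
    · intro m _ m' _ h
      have h' : pt m = pt m' := h
      ext1
      apply Ideal.comap_injective_of_surjective (Ideal.Quotient.mk J) Ideal.Quotient.mk_surjective
      rw [hpt, hpt, h']
    · intro x hx
      simp only [Set.Finite.mem_toFinset, Set.mem_ofPred_eq] at hx
      have hker : ∀ q ∈ J, MvPolynomial.eval x q = 0 := by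
        have : J ≤ RingHom.ker (MvPolynomial.eval x) := by
          rw [hJ, Ideal.map_le_iff_le_comap]
          intro f hf
          rw [Ideal.mem_comap, RingHom.mem_ker, ← haev]
          exact hx f hf
        exact fun q hq => this hq
      let φ := Ideal.Quotient.lift J (MvPolynomial.eval x) hker
      have hφ : Function.Surjective φ :=
        fun c => ⟨Ideal.Quotient.mk J (MvPolynomial.C c), by simp [φ]⟩
      refine ⟨⟨RingHom.ker φ, RingHom.ker_isMaximal_of_surjective φ hφ⟩, Finset.mem_univ _, ?_⟩
      funext i
      have h := hpt ⟨RingHom.ker φ, RingHom.ker_isMaximal_of_surjective φ hφ⟩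
      have h2 : (MvPolynomial.X i - MvPolynomial.C (x i) :
          MvPolynomial (Fin n) (AlgebraicClosure K)) ∈
          (RingHom.ker φ).comap (Ideal.Quotient.mk J) := by
        rw [Ideal.mem_comap, RingHom.mem_ker, Ideal.Quotient.lift_mk]
        simp
      rw [h, RingHom.mem_ker] at h2
      simpa [sub_eq_zero] using h2
    · intro m _
      have := m.isMaximal
      congr 1
      exact lemB2 K n I (pt m) m.asIdeal (hpt m)
  · intro m
    have h : (MvPolynomial.map (algebraMap K (AlgebraicClosure K)) p -
        MvPolynomial.C (MvPolynomial.aeval (pt m) p)) ∈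
          m.asIdeal.comap (Ideal.Quotient.mk J) := by
      rw [hpt, RingHom.mem_ker, haev]
      simp
    rw [Ideal.mem_comap, map_sub] at h
    exact h
end

section
/- Poisson-type factorization: let K be a field, I ⊆ K[X₁,…,Xₙ] a zero-dimensional ideal, and f₀ = U₀ − U₁X₁ − ⋯ − UₙXₙ ∈ K[U₀,…,Uₙ][X]. Then the determinant of multiplication by f₀ on (K(U)[X])/(I·K(U)[X]) equals ∏_{x ∈ V(I)} (U₀ − x₁U₁ − ⋯ − xₙUₙ)^{μ(x)}, the Chow form of V(I) with multiplicities. -/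
set_option maxHeartbeats 1000000

open MvPolynomial

/-- The canonical embedding of `K(U₀,…,Uₙ)` into `K̄(U₀,…,Uₙ)`. -/
noncomputable def fracMapToClosure (K : Type*) [Field K] (N : ℕ) :
    FractionRing (MvPolynomial (Fin N) K) →+*
      FractionRing (MvPolynomial (Fin N) (AlgebraicClosure K)) :=
  IsLocalization.lift (M := nonZeroDivisors (MvPolynomial (Fin N) K))
    (g := (algebraMap (MvPolynomial (Fin N) (AlgebraicClosure K))
        (FractionRing (MvPolynomial (Fin N) (AlgebraicClosure K)))).comp
      (MvPolynomial.map (algebraMap K (AlgebraicClosure K))))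
    (by
      intro y
      have hy0 : (y : MvPolynomial (Fin N) K) ≠ 0 :=
        nonZeroDivisors.ne_zero y.2
      have h1 : MvPolynomial.map (algebraMap K (AlgebraicClosure K)) (y : MvPolynomial (Fin N) K) ≠ 0 := by
        intro h
        exact hy0 (MvPolynomial.map_injective _ (algebraMap K (AlgebraicClosure K)).injective
          (by simpa using h))
      have h2 : (algebraMap (MvPolynomial (Fin N) (AlgebraicClosure K))
          (FractionRing (MvPolynomial (Fin N) (AlgebraicClosure K))))
          (MvPolynomial.map (algebraMap K (AlgebraicClosure K)) (y : MvPolynomial (Fin N) K)) ≠ 0 := by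
        intro h
        exact h1 (IsFractionRing.injective (MvPolynomial (Fin N) (AlgebraicClosure K))
          (FractionRing (MvPolynomial (Fin N) (AlgebraicClosure K))) (by simpa using h))
      exact isUnit_iff_ne_zero.mpr h2)

open scoped TensorProduct in
noncomputable def pdcEquiv (k k' : Type*) [Field k] [Field k'] [Algebra k k'] (n : ℕ)
    (I : Ideal (MvPolynomial (Fin n) k)) :
    k' ⊗[k] (MvPolynomial (Fin n) k ⧸ I) ≃ₐ[k']
      MvPolynomial (Fin n) k' ⧸ I.map (MvPolynomial.map (algebraMap k k')) :=
  (Algebra.TensorProduct.tensorQuotientEquiv (R := k) k' (MvPolynomial (Fin n) k) k' I).trans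
    (Ideal.quotientEquivAlg _ _ (MvPolynomial.algebraTensorAlgEquiv k k') (by
      have h : (MvPolynomial.map (algebraMap k k') :
          MvPolynomial (Fin n) k →+* MvPolynomial (Fin n) k') =
          (MvPolynomial.algebraTensorAlgEquiv (σ := Fin n) k k').toAlgHom.toRingHom.comp
          (Algebra.TensorProduct.includeRight (R := k) (A := k')
            (B := MvPolynomial (Fin n) k)).toRingHom := by
        ext p
        · simp
        · simp
      rw [h, ← Ideal.map_map]
      rfl))

open scoped TensorProduct in
theorem pdcEquiv_tmul (k k' : Type*) [Field k] [Field k'] [Algebra k k'] (n : ℕ)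
    (I : Ideal (MvPolynomial (Fin n) k)) (a : k') (p : MvPolynomial (Fin n) k) :
    pdcEquiv k k' n I (a ⊗ₜ Ideal.Quotient.mk I p) =
      Ideal.Quotient.mk _ (a • MvPolynomial.map (algebraMap k k') p) := by
  rw [← MvPolynomial.algebraTensorAlgEquiv_tmul]
  rfl

open scoped TensorProduct in
theorem pdc_norm_tmul (k k' A : Type*) [Field k] [Field k'] [Algebra k k'] [CommRing A]
    [Algebra k A] [Module.Finite k A] (a : A) :
    Algebra.norm k' ((1 : k') ⊗ₜ[k] a) = algebraMap k k' (Algebra.norm k a) := by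
  rw [Algebra.norm_apply, Algebra.norm_apply, ← LinearMap.det_baseChange]
  congr 1
  ext x
  simp

theorem pdc_baseChange {E F : Type*} [Field E] [Field F] (φ : E →+* F) (n : ℕ)
    (J : Ideal (MvPolynomial (Fin n) E)) [FiniteDimensional E (MvPolynomial (Fin n) E ⧸ J)]
    (f : MvPolynomial (Fin n) E) :
    φ (Algebra.norm E (Ideal.Quotient.mk J f)) =
      Algebra.norm F (Ideal.Quotient.mk (J.map (MvPolynomial.map φ)) (MvPolynomial.map φ f)) := by
  let := φ.toAlgebra
  have h := pdc_norm_tmul E F _ (Ideal.Quotient.mk J f)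
  rw [← Algebra.norm_eq_of_algEquiv (pdcEquiv E F n J), pdcEquiv_tmul, one_smul] at h
  exact h.symm

theorem pdc_finite {E F : Type*} [Field E] [Field F] (φ : E →+* F) (n : ℕ)
    (J : Ideal (MvPolynomial (Fin n) E)) :
    FiniteDimensional E (MvPolynomial (Fin n) E ⧸ J) ↔
    FiniteDimensional F (MvPolynomial (Fin n) F ⧸ J.map (MvPolynomial.map φ)) := by
  let := φ.toAlgebra
  constructor
  · intro h
    exact Module.Finite.equiv (pdcEquiv E F n J).toLinearEquiv
  · intro h
    have := Module.Finite.equiv (pdcEquiv E F n J).symm.toLinearEquiv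
    exact Module.Finite.of_finite_tensorProduct_of_faithfullyFlat F

theorem pdc_det_block {ι R : Type*} [Fintype ι] [CommRing R] {α : ι → Type*} [∀ i, Fintype (α i)]
    [∀ i, DecidableEq (α i)] [DecidableEq (Σ i, α i)] (M : Matrix (Σ i, α i) (Σ i, α i) R)
    (hz : ∀ x y, x.1 ≠ y.1 → M x y = 0) :
    M.det = ∏ i, (Matrix.of fun x y : α i => M ⟨i, x⟩ ⟨i, y⟩).det := by
  classical
  let : LinearOrder ι := linearOrderOfSTO WellOrderingRel
  have ht : M.BlockTriangular Sigma.fst := by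
    intro x y hxy
    exact hz x y hxy.ne'
  refine Eq.trans (by convert ht.det_fintype) ?_
  refine Finset.prod_congr rfl fun i _ => ?_
  rw [← Matrix.det_reindex_self (Equiv.sigmaSubtype i)]
  congr 1

theorem pdc_det_pi {ι R : Type*} [Fintype ι] [Field R] (M : ι → Type*)
    [∀ i, CommRing (M i)] [∀ i, Algebra R (M i)] [∀ i, Module.Finite R (M i)] (a : ∀ i, M i) :
    Algebra.norm R a = ∏ i, Algebra.norm R (a i) := by
  classical
  let b := fun i => Module.Free.chooseBasis R (M i)
  rw [Algebra.norm_eq_matrix_det (Pi.basis b)]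
  simp_rw [fun i => Algebra.norm_eq_matrix_det (b i) (a i)]
  rw [pdc_det_block]
  · refine Finset.prod_congr rfl fun i _ => ?_
    congr 1
    ext x y
    rw [Matrix.of_apply, Algebra.leftMulMatrix_eq_repr_mul, Algebra.leftMulMatrix_eq_repr_mul,
      Pi.basis_repr, Pi.basis_apply, Pi.mul_apply, Pi.single_eq_same]
  · rintro ⟨i, i'⟩ ⟨j, j'⟩ h
    rw [Algebra.leftMulMatrix_eq_repr_mul, Pi.basis_repr, Pi.basis_apply]
    have : (a * Pi.single j ((b j) j')) i = 0 := by
      rw [Pi.mul_apply, Pi.single_eq_of_ne h, mul_zero]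
    simp [this]

theorem pdc_norm_nilp {F A : Type*} [Field F] [CommRing A] [Algebra F A] [Module.Finite F A]
    (c : F) (a : A) (ha : IsNilpotent (algebraMap F A c - a)) :
    Algebra.norm F a = c ^ Module.finrank F A := by
  have h1 : IsNilpotent (Algebra.lmul F A (algebraMap F A c - a)) := ha.map _
  have h2 := congrArg (Polynomial.eval c) h1.charpoly_eq_X_pow_finrank
  rw [LinearMap.eval_charpoly] at h2
  rw [Algebra.norm_apply]
  simp only [Polynomial.eval_pow, Polynomial.eval_X] at h2
  rw [← h2]
  congr 1
  ext x
  simp [Algebra.smul_def]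

open scoped TensorProduct in
theorem pdc_core {L F B : Type*} [Field L] [Field F] [Algebra L F] [CommRing B] [Algebra L B]
    [Module.Finite L B] [Fintype (MaximalSpectrum B)] (n : ℕ) (u0 : F) (u : Fin n → F) (b : Fin n → B)
    (a : MaximalSpectrum B → Fin n → L) (h : ∀ m i, b i - algebraMap L B (a m i) ∈ m.asIdeal) :
    Algebra.norm F (u0 ⊗ₜ[L] (1 : B) - ∑ i, u i ⊗ₜ[L] b i) =
      ∏ m : MaximalSpectrum B, (u0 - ∑ i, algebraMap L F (a m i) * u i) ^
        Module.finrank L (Localization.AtPrime m.asIdeal) := by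
  have : IsArtinianRing B := IsArtinianRing.of_finite L B
  have hfin (p : Ideal B) [p.IsPrime] : Module.Finite L (Localization.AtPrime p) :=
    Module.Finite.of_surjective (Algebra.algHom L B (Localization.AtPrime p)).toLinearMap
      (IsArtinianRing.localization_surjective p.primeCompl (Localization.AtPrime p))
  classical
  let e : B ≃ₐ[L] (∀ m : MaximalSpectrum B, Localization.AtPrime m.asIdeal) :=
    (MaximalSpectrum.toPiLocalizationEquiv B).restrictScalars L
  let e2 := (Algebra.TensorProduct.congr (AlgEquiv.refl : F ≃ₐ[F] F) e).trans
    (Algebra.TensorProduct.piRight L F F (fun m : MaximalSpectrum B => Localization.AtPrime m.asIdeal))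
  rw [← Algebra.norm_eq_of_algEquiv e2, pdc_det_pi]
  refine Finset.prod_congr rfl fun m _ => ?_
  rw [← Module.finrank_baseChange (R := F)]
  apply pdc_norm_nilp
  have he : ∀ (v : F) (y : B), e2 (v ⊗ₜ y) m = v ⊗ₜ algebraMap B (Localization.AtPrime m.asIdeal) y :=
    fun v y => rfl
  have : IsArtinianRing (Localization.AtPrime m.asIdeal) := IsArtinianRing.of_finite L _
  have hn : ∀ i, IsNilpotent (algebraMap B (Localization.AtPrime m.asIdeal) (b i - algebraMap L B (a m i))) := by
    intro i
    have h1 := (IsLocalization.AtPrime.to_map_mem_maximal_iff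
      (Localization.AtPrime m.asIdeal) m.asIdeal _).2 (h m i)
    obtain ⟨N, hN⟩ := IsArtinianRing.isNilpotent_jacobson_bot (R := Localization.AtPrime m.asIdeal)
    rw [IsLocalRing.jacobson_eq_maximalIdeal _ bot_ne_top] at hN
    exact ⟨N, by simpa [hN] using Ideal.pow_mem_pow h1 N⟩
  have key : algebraMap F (F ⊗[L] Localization.AtPrime m.asIdeal) (u0 - ∑ i, algebraMap L F (a m i) * u i)
      - e2 (u0 ⊗ₜ[L] (1 : B) - ∑ i, u i ⊗ₜ[L] b i) m =
      ∑ i, u i ⊗ₜ (algebraMap B (Localization.AtPrime m.asIdeal) (b i - algebraMap L B (a m i))) := by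
    rw [map_sub e2, map_sum e2, Pi.sub_apply, Finset.sum_apply, map_sub, map_sum]
    simp only [he, map_sub, map_one, TensorProduct.tmul_sub, Finset.sum_sub_distrib]
    have h3 : ∀ i, u i ⊗ₜ[L] algebraMap B (Localization.AtPrime m.asIdeal) (algebraMap L B (a m i)) =
       algebraMap F (F ⊗[L] Localization.AtPrime m.asIdeal) (algebraMap L F (a m i) * u i) := by
      intro i
      rw [← IsScalarTower.algebraMap_apply L B, Algebra.algebraMap_eq_smul_one, TensorProduct.tmul_smul,
        TensorProduct.smul_tmul', Algebra.TensorProduct.algebraMap_apply, Algebra.smul_def]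
      rfl
    simp only [h3]
    rw [Algebra.TensorProduct.algebraMap_apply]
    simp
  rw [key]
  refine isNilpotent_sum fun i _ => ?_
  have : u i ⊗ₜ[L] (algebraMap B (Localization.AtPrime m.asIdeal) (b i - algebraMap L B (a m i))) =
    (u i ⊗ₜ 1) * Algebra.TensorProduct.includeRight (R := L) (A := F) (algebraMap B (Localization.AtPrime m.asIdeal) (b i - algebraMap L B (a m i))) := by
    simp
  rw [this]
  exact Commute.isNilpotent_mul_left (Commute.all _ _) ((hn i).map _)

open scoped TensorProduct in
theorem pdc_core2 {L F : Type*} [Field L] [Field F] (ψ : L →+* F) (n : ℕ)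
    (J : Ideal (MvPolynomial (Fin n) L)) [FiniteDimensional L (MvPolynomial (Fin n) L ⧸ J)]
    [Fintype (MaximalSpectrum (MvPolynomial (Fin n) L ⧸ J))]
    (u0 : F) (u : Fin n → F)
    (a : MaximalSpectrum (MvPolynomial (Fin n) L ⧸ J) → Fin n → L)
    (h : ∀ m i, Ideal.Quotient.mk J (X i - C (a m i)) ∈ m.asIdeal) :
    Algebra.norm F (Ideal.Quotient.mk (J.map (MvPolynomial.map ψ))
      (C u0 - ∑ i, C (u i) * X i)) =
      ∏ m : MaximalSpectrum (MvPolynomial (Fin n) L ⧸ J), (u0 - ∑ i, ψ (a m i) * u i) ^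
        Module.finrank L (Localization.AtPrime m.asIdeal) := by
  let := ψ.toAlgebra
  have h1 := pdc_core (L := L) (F := F) n u0 u (fun i => Ideal.Quotient.mk J (X i)) a
    (fun m i => by
      have := h m i
      rwa [map_sub] at this)
  rw [← Algebra.norm_eq_of_algEquiv (pdcEquiv L F n J)] at h1
  refine Eq.trans ?_ h1
  congr 1
  rw [map_sub (pdcEquiv L F n J), map_sum (pdcEquiv L F n J), ← map_one (Ideal.Quotient.mk J)]
  simp only [pdcEquiv_tmul]
  rw [map_sub, map_sum]
  simp only [MvPolynomial.smul_eq_C_mul, MvPolynomial.map_X, map_one, mul_one]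
  rfl

theorem pdc_mult (K : Type*) [Field K] (n : ℕ)
    (I : Ideal (MvPolynomial (Fin n) K)) (x : Fin n → AlgebraicClosure K)
    (m : Ideal (MvPolynomial (Fin n) (AlgebraicClosure K) ⧸
      I.map (MvPolynomial.map (algebraMap K (AlgebraicClosure K))))) [m.IsPrime]
    (hm : m.comap (Ideal.Quotient.mk _) = RingHom.ker (MvPolynomial.eval x)) :
    localMultiplicity K n I x =
      Module.finrank (AlgebraicClosure K) (Localization.AtPrime m) := by
  let J := I.map (MvPolynomial.map (algebraMap K (AlgebraicClosure K)))
  let mx := RingHom.ker (MvPolynomial.eval x)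
  have hp : mx.IsPrime := RingHom.ker_isPrime _
  have hs : Algebra.algebraMapSubmonoid (MvPolynomial (Fin n) (AlgebraicClosure K) ⧸ J) mx.primeCompl
      = m.primeCompl := by
    ext y
    obtain ⟨y, rfl⟩ := Ideal.Quotient.mk_surjective y
    have hy : ∀ z, Ideal.Quotient.mk J z ∈ m ↔ z ∈ mx := fun z => by
      change _ ↔ z ∈ RingHom.ker (MvPolynomial.eval x)
      rw [← hm]; rfl
    constructor
    · rintro ⟨z, hz, hzy⟩
      rw [← hzy]
      exact fun h => hz ((hy z).1 h)
    · intro h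
      exact ⟨y, fun h' => h ((hy y).2 h'), rfl⟩
  have hl : IsLocalization m.primeCompl (Localization.AtPrime mx ⧸ 
      J.map (algebraMap _ (Localization.AtPrime mx))) := by
    rw [← hs]; infer_instance
  let e := IsLocalization.algEquiv m.primeCompl (Localization.AtPrime mx ⧸ 
      J.map (algebraMap _ (Localization.AtPrime mx))) (Localization.AtPrime m)
  have hc : ∀ c : AlgebraicClosure K, e (Ideal.Quotient.mk _ (algebraMap _ (Localization.AtPrime mx)
      (algebraMap (AlgebraicClosure K) (MvPolynomial (Fin n) (AlgebraicClosure K)) c))) =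
      algebraMap (AlgebraicClosure K) (Localization.AtPrime m) c := by
    intro c
    exact e.commutes (Ideal.Quotient.mk J (C c))
  unfold localMultiplicity
  refine LinearEquiv.finrank_eq { e.toRingEquiv.toAddEquiv with map_smul' := ?_ }
  intro c y
  obtain ⟨y, rfl⟩ := Ideal.Quotient.mk_surjective y
  simp only [RingHom.id_apply]
  rw [Algebra.smul_def (A := Localization.AtPrime m), ← hc]
  refine Eq.trans ?_ (map_mul e _ _)
  refine congrArg e ?_
  rw [← map_mul]
  refine congrArg (Ideal.Quotient.mk _) (?_ : c • y = _)
  rw [Algebra.smul_def]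
  rfl

theorem pdc_map_algebraMap (K : Type*) [Field K] (N : ℕ) (p : MvPolynomial (Fin N) K) :
    fracMapToClosure K N (algebraMap _ _ p) =
      algebraMap (MvPolynomial (Fin N) (AlgebraicClosure K)) _
        (MvPolynomial.map (algebraMap K (AlgebraicClosure K)) p) := by
  unfold fracMapToClosure
  rw [IsLocalization.lift_eq]
  rfl

/-- The maximal ideal of the quotient ring attached to a point of the variety. -/
noncomputable def pdcMax (L : Type*) [Field L] (n : ℕ) (J : Ideal (MvPolynomial (Fin n) L))
    (x : Fin n → L) (hx : ∀ f ∈ J, MvPolynomial.eval x f = 0) :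
    MaximalSpectrum (MvPolynomial (Fin n) L ⧸ J) :=
  ⟨RingHom.ker (Ideal.Quotient.lift J (MvPolynomial.eval x) hx),
    RingHom.ker_isMaximal_of_surjective _ (fun c => ⟨Ideal.Quotient.mk J (C c), by simp⟩)⟩

theorem pdc_point (L : Type*) [Field L] [IsAlgClosed L] (n : ℕ) (J : Ideal (MvPolynomial (Fin n) L))
    [FiniteDimensional L (MvPolynomial (Fin n) L ⧸ J)]
    (m : MaximalSpectrum (MvPolynomial (Fin n) L ⧸ J)) :
    ∃ x : Fin n → L, ∃ hx : ∀ f ∈ J, MvPolynomial.eval x f = 0, pdcMax L n J x hx = m := by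
  obtain ⟨m, hm⟩ := m
  have hb : Function.Bijective (algebraMap L ((MvPolynomial (Fin n) L ⧸ J) ⧸ m)) :=
    IsAlgClosed.algebraMap_bijective_of_isIntegral
  choose x hx using fun i => hb.2 (Ideal.Quotient.mk m (Ideal.Quotient.mk J (X i)))
  have key : ∀ f, algebraMap L ((MvPolynomial (Fin n) L ⧸ J) ⧸ m) (MvPolynomial.eval x f) =
      Ideal.Quotient.mk m (Ideal.Quotient.mk J f) := by
    have : (algebraMap L ((MvPolynomial (Fin n) L ⧸ J) ⧸ m)).comp (MvPolynomial.eval x) =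
      (Ideal.Quotient.mk m).comp (Ideal.Quotient.mk J) := by
      ext i
      · simp; rfl
      · simp [hx]
    exact fun f => RingHom.congr_fun this f
  have hJ : ∀ f ∈ J, MvPolynomial.eval x f = 0 := by
    intro f hf
    apply hb.1
    rw [key, Ideal.Quotient.eq_zero_iff_mem.2 hf, map_zero, map_zero]
  refine ⟨x, hJ, ?_⟩
  ext y
  obtain ⟨y, rfl⟩ := Ideal.Quotient.mk_surjective y
  simp only [pdcMax, RingHom.mem_ker, Ideal.Quotient.lift_mk]
  rw [← Ideal.Quotient.eq_zero_iff_mem, ← key, map_eq_zero_iff _ hb.1]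

/-- **Poisson-type factorization** (Proposition `facto u-res`, via Stickelberger):
for a zero-dimensional ideal `I ⊆ K[X₁,…,Xₙ]` and
`f₀ = U₀ − U₁X₁ − ⋯ − UₙXₙ`, the determinant of multiplication by `f₀` on
`K(U)[X]/I·K(U)[X]` equals the Chow form `∏_{x ∈ V(I)} (U₀ − x₁U₁ − ⋯ − xₙUₙ)^{μ(x)}`
of `V(I)` with multiplicities (the identity being read in `K̄(U₀,…,Uₙ)`). -/
theorem poisson_determinant_chow_form
    (K : Type*) [Field K] [CharZero K] (n : ℕ)
    (I : Ideal (MvPolynomial (Fin n) K))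
    (IU : Ideal (MvPolynomial (Fin n) (FractionRing (MvPolynomial (Fin (n + 1)) K))))
    (hIU : IU = I.map (MvPolynomial.map
      ((algebraMap (MvPolynomial (Fin (n + 1)) K)
          (FractionRing (MvPolynomial (Fin (n + 1)) K))).comp MvPolynomial.C)))
    [FiniteDimensional (FractionRing (MvPolynomial (Fin (n + 1)) K))
      (MvPolynomial (Fin n) (FractionRing (MvPolynomial (Fin (n + 1)) K)) ⧸ IU)]
    (V : Set (Fin n → AlgebraicClosure K))
    (hV : V = {x | ∀ f ∈ I, MvPolynomial.aeval x f = 0})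
    (hVfin : V.Finite) :
    fracMapToClosure K (n + 1)
      (LinearMap.det (LinearMap.mulLeft (FractionRing (MvPolynomial (Fin (n + 1)) K))
        (Ideal.Quotient.mk IU
          (MvPolynomial.C (algebraMap (MvPolynomial (Fin (n + 1)) K)
              (FractionRing (MvPolynomial (Fin (n + 1)) K)) (MvPolynomial.X 0)) -
            ∑ i : Fin n,
              MvPolynomial.C (algebraMap (MvPolynomial (Fin (n + 1)) K)
                (FractionRing (MvPolynomial (Fin (n + 1)) K)) (MvPolynomial.X i.succ)) *
                MvPolynomial.X i))))
      = ∏ x ∈ hVfin.toFinset,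
          (algebraMap (MvPolynomial (Fin (n + 1)) (AlgebraicClosure K))
              (FractionRing (MvPolynomial (Fin (n + 1)) (AlgebraicClosure K))) (MvPolynomial.X 0) -
            ∑ i : Fin n,
              algebraMap (MvPolynomial (Fin (n + 1)) (AlgebraicClosure K))
                  (FractionRing (MvPolynomial (Fin (n + 1)) (AlgebraicClosure K)))
                  (MvPolynomial.C (x i)) *
                algebraMap (MvPolynomial (Fin (n + 1)) (AlgebraicClosure K))
                  (FractionRing (MvPolynomial (Fin (n + 1)) (AlgebraicClosure K)))
                  (MvPolynomial.X i.succ)) ^ localMultiplicity K n I x := by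
  classical
  have hmap : IU.map (MvPolynomial.map (fracMapToClosure K (n + 1))) =
      (I.map (MvPolynomial.map (algebraMap K (AlgebraicClosure K)))).map
        (MvPolynomial.map ((algebraMap (MvPolynomial (Fin (n + 1)) (AlgebraicClosure K))
          (FractionRing (MvPolynomial (Fin (n + 1)) (AlgebraicClosure K)))).comp C)) := by
    rw [hIU, Ideal.map_map, Ideal.map_map]
    congr 1
    ext i
    · simp [pdc_map_algebraMap]
    · simp
  have hfin1 := (pdc_finite (fracMapToClosure K (n + 1)) n IU).1 inferInstance
  rw [hmap, ← pdc_finite] at hfin1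
  have hb := pdc_baseChange (fracMapToClosure K (n + 1)) n IU
    (C (algebraMap (MvPolynomial (Fin (n + 1)) K)
              (FractionRing (MvPolynomial (Fin (n + 1)) K)) (X 0)) -
            ∑ i : Fin n,
              C (algebraMap (MvPolynomial (Fin (n + 1)) K)
                (FractionRing (MvPolynomial (Fin (n + 1)) K)) (X i.succ)) * X i)
  refine Eq.trans hb ?_
  rw [hmap]
  simp only [map_sub, map_sum, map_mul, MvPolynomial.map_C, MvPolynomial.map_X, pdc_map_algebraMap]
  set J := I.map (MvPolynomial.map (algebraMap K (AlgebraicClosure K))) with hJ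
  have hart : IsArtinianRing (MvPolynomial (Fin n) (AlgebraicClosure K) ⧸ J) :=
    IsArtinianRing.of_finite (AlgebraicClosure K) _
  let : Fintype (MaximalSpectrum (MvPolynomial (Fin n) (AlgebraicClosure K) ⧸ J)) :=
    Fintype.ofFinite _
  choose a ha ham using pdc_point (AlgebraicClosure K) n J
  have hVJ : ∀ x, x ∈ V ↔ ∀ f ∈ J, MvPolynomial.eval x f = 0 := by
    intro x
    rw [hV]
    have hev : ∀ f : MvPolynomial (Fin n) K, MvPolynomial.eval x
        (MvPolynomial.map (algebraMap K (AlgebraicClosure K)) f) = MvPolynomial.aeval x f := by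
      intro f
      rw [MvPolynomial.eval_map, MvPolynomial.aeval_def]
    constructor
    · intro h
      have : J ≤ RingHom.ker (MvPolynomial.eval x) := by
        rw [hJ, Ideal.map_le_iff_le_comap]
        intro f hf
        change MvPolynomial.eval x _ = 0
        rw [hev]
        exact h f hf
      exact fun f hf => this hf
    · intro h f hf
      rw [← hev]
      exact h _ (Ideal.mem_map_of_mem _ hf)
  have hinj : ∀ m x, (∀ i, Ideal.Quotient.mk J (X i - C (x i)) ∈
      MaximalSpectrum.asIdeal m) → a m = x := by
    intro m x h
    funext i
    have := h i
    rw [← ham m] at this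
    simpa [pdcMax, sub_eq_zero] using this
  have hmem : ∀ m i, Ideal.Quotient.mk J (X i - C (a m i)) ∈ MaximalSpectrum.asIdeal m := by
    intro m i
    have : Ideal.Quotient.mk J (X i - C (a m i)) ∈ (pdcMax _ n J (a m) (ha m)).asIdeal := by
      simp [pdcMax]
    rwa [ham m] at this
  have hc := pdc_core2 ((algebraMap (MvPolynomial (Fin (n + 1)) (AlgebraicClosure K))
          (FractionRing (MvPolynomial (Fin (n + 1)) (AlgebraicClosure K)))).comp C) n J
    (algebraMap (MvPolynomial (Fin (n + 1)) (AlgebraicClosure K)) _ (X 0))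
    (fun i => algebraMap (MvPolynomial (Fin (n + 1)) (AlgebraicClosure K)) _ (X i.succ)) a hmem
  simp only [map_sub, map_sum, map_mul] at hc
  refine Eq.trans hc ?_
  refine Finset.prod_bij (fun m _ => a m) ?_ ?_ ?_ ?_
  · intro m _
    rw [Set.Finite.mem_toFinset, hVJ]
    exact ha m
  · intro m _ m' _ h
    rw [← ham m, ← ham m']
    congr 1
  · intro x hx
    rw [Set.Finite.mem_toFinset, hVJ] at hx
    refine ⟨pdcMax _ n J x hx, Finset.mem_univ _, hinj _ _ ?_⟩
    intro i
    simp [pdcMax]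
  · intro m _
    rw [pdc_mult K n I (a m) m.asIdeal]
    · rfl
    · conv_lhs => rw [← ham m]
      ext y
      rfl
end

section
/- Number of real roots via Sturm–Habicht: let P ∈ ℝ[T] be a nonconstant polynomial. The number of distinct real roots of P equals the number of sign changes (in the generalized Sturm–Habicht sense) computed from the signs of the principal coefficients of the signed subresultant sequence sres(P, P'). -/
open Polynomial

/-- The Sylvester–Habicht style matrix whose determinant gives the coefficient of `X^k`
in the `j`-th subresultant of `P` and `Q`, where `p` and `q` are the (formal) degrees
of `P` and `Q`. Its rows are the coefficient vectors of `X^{q−j−1−i}·P` (for `i < q−j`)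
and `X^{p−j−1−i}·Q`, listed on the monomials `X^{p+q−j−1}, …, X^{j+1}` followed by the
coefficient of `X^k`. -/
noncomputable def syHaMatrix {R : Type*} [CommRing R] (p q j k : ℕ) (P Q : Polynomial R) :
    Matrix (Fin (p + q - 2 * j)) (Fin (p + q - 2 * j)) R :=
  fun i c =>
    (if (i : ℕ) < q - j then X ^ (q - j - 1 - (i : ℕ)) * P
      else X ^ (p - j - 1 - ((i : ℕ) - (q - j))) * Q).coeff
    (if (c : ℕ) + 1 < p + q - 2 * j then p + q - j - 1 - (c : ℕ) else k)

/-- The `j`-th signed subresultant polynomial of `P` and `Q` (of formal degrees `p`, `q`),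
defined determinantally, with the sign `(−1)^{(p−j)(p−j−1)/2}` of the signed subresultant
(Sturm–Habicht) sequence; by convention the `p`-th one is `P` itself. -/
noncomputable def signedSubres {R : Type*} [CommRing R] (p q j : ℕ) (P Q : Polynomial R) :
    Polynomial R :=
  if j = p then P else
    (-1 : Polynomial R) ^ ((p - j) * (p - j - 1) / 2) *
      ∑ k ∈ Finset.range (j + 1), Polynomial.C (syHaMatrix p q j k P Q).det * X ^ k

/-- The generalized "Permanences minus Variations" count of a finite sequence of reals
(Basu–Pollack–Roy): for each pair of consecutive nonzero entries `s_i, s_j` (all entries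
strictly between them being zero), if `j − i` is odd it contributes
`(−1)^{(j−i−1)/2}·sign(s_i·s_j)`, and otherwise it contributes `0`. -/
noncomputable def PmV (l : List ℝ) : ℤ :=
  let idx := (List.finRange l.length).filter (fun i => decide (l.get i ≠ 0))
  ((idx.zip idx.tail).map (fun ij =>
    let gap : ℕ := (ij.2 : ℕ) - (ij.1 : ℕ)
    if gap % 2 = 1 then
      (-1 : ℤ) ^ ((gap - 1) / 2) * (if 0 < l.get ij.1 * l.get ij.2 then 1 else -1)
    else 0)).sum

noncomputable def locC (a : ℝ) (F : ℝ[X]) : ℝ :=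
  (F /ₘ (X - C a) ^ F.rootMultiplicity a).eval a

theorem locC_zero (a : ℝ) : locC a 0 = 0 := by simp [locC]

theorem loc_spec (a : ℝ) (F : ℝ[X]) (hF : F ≠ 0) :
    ∃ G, F = (X - C a) ^ F.rootMultiplicity a * G ∧ G.eval a = locC a F ∧ locC a F ≠ 0 :=
  ⟨_, (pow_mul_divByMonic_rootMultiplicity_eq F a).symm, rfl,
    eval_divByMonic_pow_rootMultiplicity_ne_zero a hF⟩

theorem loc_unique (a : ℝ) (F G : ℝ[X]) (m : ℕ) (h : F = (X - C a) ^ m * G)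
    (hG : G.eval a ≠ 0) : F.rootMultiplicity a = m ∧ locC a F = G.eval a := by
  have hG0 : G ≠ 0 := by rintro rfl; simp at hG
  have hm : F.rootMultiplicity a = m := by
    rw [h, rootMultiplicity_mul (mul_ne_zero (pow_ne_zero _ (X_sub_C_ne_zero a)) hG0),
      rootMultiplicity_X_sub_C_pow, rootMultiplicity_eq_zero (by simpa using hG), add_zero]
  refine ⟨hm, ?_⟩
  have := pow_mul_divByMonic_rootMultiplicity_eq F a
  rw [hm] at this
  have h2 := mul_left_cancel₀ (pow_ne_zero m (X_sub_C_ne_zero a)) (this.trans h)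
  rw [locC, hm, h2]

/-- The jump of `Q / P` at `a`. -/
noncomputable def jump (a : ℝ) (Q P : ℝ[X]) : ℤ :=
  if Q.rootMultiplicity a < P.rootMultiplicity a ∧
      Odd (P.rootMultiplicity a + Q.rootMultiplicity a) then
    (SignType.sign (locC a P * locC a Q) : ℤ) else 0

noncomputable def halfJump (a : ℝ) (F : ℝ[X]) : ℤ :=
  if Odd (F.rootMultiplicity a) then (SignType.sign (locC a F) : ℤ) else 0

theorem loc_mul (a : ℝ) (P Q : ℝ[X]) (hP : P ≠ 0) (hQ : Q ≠ 0) :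
    (P * Q).rootMultiplicity a = P.rootMultiplicity a + Q.rootMultiplicity a ∧
      locC a (P * Q) = locC a P * locC a Q := by
  obtain ⟨G, h1, h2, h3⟩ := loc_spec a P hP
  obtain ⟨H, k1, k2, k3⟩ := loc_spec a Q hQ
  have := loc_unique a (P * Q) (G * H) (P.rootMultiplicity a + Q.rootMultiplicity a)
    (by conv_lhs => rw [h1, k1]
        ring) (by simp [h2, k2, h3, k3])
  simpa [h2, k2] using this

theorem jump_add (a : ℝ) (P Q : ℝ[X]) (hP : P ≠ 0) (hQ : Q ≠ 0) :
    jump a Q P + jump a P Q = halfJump a (P * Q) := by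
  obtain ⟨h1, h2⟩ := loc_mul a P Q hP hQ
  rw [jump, jump, halfJump, h1, h2, mul_comm (locC a Q), add_comm (rootMultiplicity a Q)]
  by_cases ho : Odd (P.rootMultiplicity a + Q.rootMultiplicity a)
  · have : P.rootMultiplicity a ≠ Q.rootMultiplicity a := by
      intro h; rw [h] at ho; obtain ⟨k, hk⟩ := ho; lia
    rcases lt_or_gt_of_ne this with h | h
    · simp [ho, h, h.not_gt]
    · simp [ho, h, h.not_gt]
  · simp [ho]

theorem jump_zero (a : ℝ) (P : ℝ[X]) : jump a 0 P = 0 := by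
  simp [jump, locC_zero]

theorem jump_of_not_root (a : ℝ) (Q P : ℝ[X]) (h : P.rootMultiplicity a = 0) : jump a Q P = 0 := by
  simp [jump, h]

theorem loc_add (a : ℝ) (Q D R : ℝ[X]) (hQ : Q ≠ 0) (hR : R ≠ 0)
    (hlt : R.rootMultiplicity a < Q.rootMultiplicity a) :
    (D * Q + R).rootMultiplicity a = R.rootMultiplicity a ∧
      locC a (D * Q + R) = locC a R := by
  obtain ⟨G, h1, h2, h3⟩ := loc_spec a Q hQ
  obtain ⟨H, k1, k2, k3⟩ := loc_spec a R hR
  obtain ⟨e, he⟩ := Nat.exists_eq_add_of_lt hlt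
  have := loc_unique a (D * Q + R) (D * (X - C a) ^ (e + 1) * G + H) (R.rootMultiplicity a)
    (by conv_lhs => rw [h1, k1, he]
        ring) (by simp [k2, k3])
  simpa [k2] using this

theorem jump_mod (a : ℝ) (P Q D R : ℝ[X]) (hQ : Q ≠ 0) (h : P = D * Q + R) :
    jump a P Q = jump a R Q := by
  have key : ∀ (A B E : ℝ[X]), B = E * Q + A → A ≠ 0 →
      A.rootMultiplicity a < Q.rootMultiplicity a → jump a B Q = jump a A Q := by
    intro A B E hB hA hlt
    obtain ⟨h1, h2⟩ := loc_add a Q E A hQ hA hlt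
    rw [jump, jump, hB, h1, h2]
  by_cases h1 : R ≠ 0 ∧ R.rootMultiplicity a < Q.rootMultiplicity a
  · exact key R P D h h1.1 h1.2
  by_cases h2 : P ≠ 0 ∧ P.rootMultiplicity a < Q.rootMultiplicity a
  · exact (key P R (-D) (by rw [h]; ring) h2.1 h2.2).symm
  have z : ∀ A : ℝ[X], ¬ (A ≠ 0 ∧ A.rootMultiplicity a < Q.rootMultiplicity a) →
      jump a A Q = 0 := by
    intro A hA
    by_cases hA0 : A = 0
    · rw [hA0, jump_zero]
    · rw [jump, if_neg]; tauto
  rw [z _ h1, z _ h2]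

theorem jump_neg (a : ℝ) (Q R : ℝ[X]) : jump a (-R) Q = - jump a R Q := by
  by_cases hR : R = 0
  · simp [hR, jump_zero]
  obtain ⟨G, h1, h2, h3⟩ := loc_spec a R hR
  obtain ⟨k1, k2⟩ := loc_unique a (-R) (-G) (R.rootMultiplicity a)
    (by conv_lhs => rw [h1]
        ring) (by simp [h2, h3])
  rw [jump, jump, k1, k2, eval_neg, h2, mul_neg, Left.sign_neg]
  split_ifs <;> simp

theorem jump_derivative (a : ℝ) (P : ℝ[X]) (hP : P ≠ 0) (ha : P.IsRoot a) :
    jump a (derivative P) P = 1 := by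
  obtain ⟨G, h1, h2, h3⟩ := loc_spec a P hP
  have hm : 0 < P.rootMultiplicity a := (rootMultiplicity_pos hP).2 ha
  obtain ⟨e, he⟩ := Nat.exists_eq_succ_of_ne_zero hm.ne'
  obtain ⟨k1, k2⟩ := loc_unique a (derivative P) ((e + 1 : ℝ[X]) * G + (X - C a) * derivative G) e
    (by conv_lhs => rw [h1, he]
        simp [derivative_mul, derivative_X_sub_C_pow]
        ring) (by
        simp only [eval_add, eval_mul, h2, eval_natCast, eval_one, eval_sub, eval_X, eval_C, sub_self, zero_mul, add_zero]
        exact mul_ne_zero (by positivity) h3)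
  rw [jump, k1, k2, he, if_pos ⟨by lia, by exact ⟨e, by lia⟩⟩, sign_pos]
  · rfl
  · simp only [eval_add, eval_mul, h2, eval_natCast, eval_one, eval_sub, eval_X, eval_C, sub_self, zero_mul, add_zero]
    have := mul_self_pos.2 h3
    nlinarith [mul_nonneg (Nat.cast_nonneg (α := ℝ) e) this.le]

noncomputable def cInd (Q P : ℝ[X]) : ℤ := ∑ a ∈ P.roots.toFinset, jump a Q P

noncomputable def halfSum (F : ℝ[X]) : ℤ := ∑ a ∈ F.roots.toFinset, halfJump a F

theorem cInd_add (P Q : ℝ[X]) (hP : P ≠ 0) (hQ : Q ≠ 0) :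
    cInd Q P + cInd P Q = halfSum (P * Q) := by
  have hPQ := mul_ne_zero hP hQ
  have key : ∀ A B : ℝ[X], A ∣ P * Q → cInd B A = ∑ a ∈ (P * Q).roots.toFinset, jump a B A := by
    intro A B hA
    apply Finset.sum_subset
    · intro x hx
      simp only [Multiset.mem_toFinset] at *
      exact Multiset.mem_of_le (roots.le_of_dvd hPQ hA) hx
    · intro x hx hx2
      apply jump_of_not_root
      rw [← count_roots, Multiset.count_eq_zero]
      simpa using hx2
  rw [key P Q (Dvd.intro _ rfl), key Q P (Dvd.intro_left _ rfl), ← Finset.sum_add_distrib, halfSum]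
  exact Finset.sum_congr rfl fun a _ => jump_add a P Q hP hQ

theorem cInd_mod (P Q D R : ℝ[X]) (hQ : Q ≠ 0) (h : P = D * Q + R) :
    cInd P Q = - cInd (-R) Q := by
  rw [cInd, cInd, ← Finset.sum_neg_distrib]
  refine Finset.sum_congr rfl fun a _ => ?_
  rw [jump_neg, neg_neg, jump_mod a P Q D R hQ h]

theorem cInd_derivative (P : ℝ[X]) (hP : P ≠ 0) :
    cInd (derivative P) P = P.roots.toFinset.card := by
  rw [cInd, Finset.sum_congr rfl (g := fun _ => 1)]
  · simp
  · intro a ha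
    exact jump_derivative a P hP (by simpa [hP] using ha)

theorem sign_eval_no_root (G : ℝ[X]) (b : ℝ) (h : ∀ x, G.IsRoot x → x < b) :
    SignType.sign (G.eval b) = SignType.sign G.leadingCoeff := by
  have hG : G ≠ 0 := by
    rintro rfl
    exact lt_irrefl b (h b (by simp))
  rcases lt_or_gt_of_ne (leadingCoeff_ne_zero.2 hG) with hl | hl
  · rw [sign_neg hl, sign_neg (eval_lt_zero_of_roots_lt_of_leadingCoeff_nonpos h hl.le)]
  · rw [sign_pos hl, sign_pos (zero_lt_eval_of_roots_lt_of_leadingCoeff_nonneg h hl.le)]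

theorem even_of_no_root (G : ℝ[X]) (h : ∀ x, ¬ G.IsRoot x) : Even G.natDegree := by
  by_contra ho
  rw [Nat.not_even_iff_odd] at ho
  have e : ((Int.negOnePow (G.natDegree : ℤ) : ℤ) : ℝ) = -1 := by
    rw [Int.negOnePow_odd _ (by simpa using ho)]; simp
  rcases le_total 0 G.leadingCoeff with hl | hl
  · have h1 := zero_lt_eval_of_roots_lt_of_leadingCoeff_nonneg (x := 0)
      (fun y hy => absurd hy (h y)) hl
    have h2 := zero_lt_negOnePow_mul_eval_of_lt_roots_of_leadingCoeff_nonneg (x := 0)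
      (fun y hy => absurd hy (h y)) hl
    rw [e] at h2
    linarith
  · have h1 := eval_lt_zero_of_roots_lt_of_leadingCoeff_nonpos (x := 0)
      (fun y hy => absurd hy (h y)) hl
    have h2 := negOnePow_mul_eval_lt_zero_of_lt_roots_of_leadingCoeff_nonpos (x := 0)
      (fun y hy => absurd hy (h y)) hl
    rw [e] at h2
    linarith

theorem halfJump_pow_mul (a b : ℝ) (hab : a < b) (k : ℕ) (G : ℝ[X]) (hG : G ≠ 0) :
    halfJump a ((X - C b) ^ k * G) = (-1) ^ k * halfJump a G := by
  obtain ⟨H, h1, h2, h3⟩ := loc_spec a G hG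
  have hk : (a - b) ^ k ≠ 0 := pow_ne_zero _ (by linarith : a - b < 0).ne
  obtain ⟨k1, k2⟩ := loc_unique a ((X - C b) ^ k * G) ((X - C b) ^ k * H) (G.rootMultiplicity a)
    (by conv_lhs => rw [h1]
        ring) (by rw [eval_mul, h2]; exact mul_ne_zero (by simpa using hk) h3)
  have hs : SignType.sign (a - b) = -1 := sign_neg (by linarith)
  rw [halfJump, halfJump, k1, k2, eval_mul, h2, sign_mul, eval_pow, sign_pow]
  simp only [eval_sub, eval_X, eval_C, hs]
  split_ifs <;> simp

theorem halfSum_eq (F : ℝ[X]) (hF : F ≠ 0) :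
    halfSum F = if Odd F.natDegree then (SignType.sign F.leadingCoeff : ℤ) else 0 := by
  induction hn : F.roots.toFinset.card generalizing F with
  | zero =>
    have h0 : F.roots.toFinset = ∅ := Finset.card_eq_zero.1 hn
    have hr : ∀ x, ¬ F.IsRoot x := by
      intro x hx
      have : x ∈ F.roots.toFinset := by simpa [hF] using hx
      simp [h0] at this
    rw [halfSum, h0, if_neg (Nat.not_odd_iff_even.2 (even_of_no_root F hr))]
    rfl
  | succ n ih =>
    have hne : F.roots.toFinset.Nonempty := Finset.card_pos.1 (by lia)
    set b := F.roots.toFinset.max' hne with hb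
    have hbm : b ∈ F.roots.toFinset := Finset.max'_mem _ _
    obtain ⟨G, h1, h2, h3⟩ := loc_spec b F hF
    set k := F.rootMultiplicity b with hk
    have hk0 : 0 < k := (rootMultiplicity_pos hF).2 (by simpa [hF] using hbm)
    have hG : G ≠ 0 := by rintro rfl; simp at h2; exact h3 h2.symm
    have hroots : G.roots.toFinset = F.roots.toFinset.erase b := by
      ext x
      by_cases hx : x = b
      · subst hx
        simp only [Multiset.mem_toFinset, mem_roots', Finset.mem_erase]
        simp [h2, h3]
      · have : x - b ≠ 0 := sub_ne_zero.2 hx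
        simp only [Multiset.mem_toFinset, mem_roots hG, Finset.mem_erase, mem_roots hF, hx,
          ne_eq, not_false_eq_true, true_and, IsRoot.def]
        conv_rhs => rw [h1]
        simp [this]
    have hlt : ∀ x, G.IsRoot x → x < b := by
      intro x hx
      have hx' : x ∈ G.roots.toFinset := by simpa [hG] using hx
      rw [hroots, Finset.mem_erase] at hx'
      exact lt_of_le_of_ne (Finset.le_max' _ _ hx'.2) hx'.1
    have hS : halfSum F = halfJump b F + (-1) ^ k * halfSum G := by
      rw [halfSum, ← Finset.add_sum_erase _ _ hbm, ← hroots, halfSum, Finset.mul_sum]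
      congr 1
      refine Finset.sum_congr rfl fun a ha => ?_
      conv_lhs => rw [h1]
      exact halfJump_pow_mul a b (hlt a (by simpa [hG] using ha)) k G hG
    have hd : F.natDegree = k + G.natDegree := by
      conv_lhs => rw [h1]
      rw [natDegree_mul (pow_ne_zero _ (X_sub_C_ne_zero b)) hG, natDegree_pow, natDegree_X_sub_C,
        mul_one]
    have hlc : F.leadingCoeff = G.leadingCoeff := by
      conv_lhs => rw [h1]
      rw [leadingCoeff_mul, leadingCoeff_pow, leadingCoeff_X_sub_C, one_pow, one_mul]
    have hbs : halfJump b F = if Odd k then (SignType.sign G.leadingCoeff : ℤ) else 0 := by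
      rw [halfJump, ← hk, ← h2, sign_eval_no_root G b hlt]
    rw [hS, hbs, ih G hG (by rw [hroots, Finset.card_erase_of_mem hbm, hn]; rfl), hd, hlc]
    rcases Nat.even_or_odd k with ke | ko
    · simp [Nat.odd_add, Nat.not_odd_iff_even.2 ke, ke.neg_one_pow]
    · simp only [ko, ↓reduceIte, ko.neg_one_pow, Nat.odd_add, true_iff, ← Nat.not_odd_iff_even]
      by_cases hg : Odd G.natDegree <;> simp [hg]

noncomputable def pterm (g : ℕ) (x y : ℝ) : ℤ :=
  if g % 2 = 1 then (-1 : ℤ) ^ ((g - 1) / 2) * (if 0 < x * y then 1 else -1) else 0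

noncomputable def pm (x : ℝ) (g : ℕ) : List ℝ → ℤ
  | [] => 0
  | y :: l => if y = 0 then pm x (g + 1) l else pterm (g + 1) x y + pm y 0 l

/-- indices (offset by `o`) and values of nonzero entries -/
noncomputable def nz (o : ℕ) : List ℝ → List (ℕ × ℝ)
  | [] => []
  | y :: l => if y = 0 then nz (o + 1) l else (o, y) :: nz (o + 1) l

noncomputable def pzip (l : List (ℕ × ℝ)) : ℤ :=
  ((l.zip l.tail).map fun ab => pterm (ab.2.1 - ab.1.1) ab.1.2 ab.2.2).sum

theorem nz_eq (l : List ℝ) (o : ℕ) :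
    nz o l = ((List.finRange l.length).filter (fun i => decide (l.get i ≠ 0))).map
      (fun i : Fin l.length => ((i : ℕ) + o, l.get i)) := by
  induction l generalizing o with
  | nil => simp [nz]
  | cons y l ih =>
    rw [nz, ih]
    simp only [List.length_cons, List.finRange_succ, List.filter_cons, List.filter_map]
    by_cases hy : y = 0
    · simp [hy, Function.comp_def]
      intro a _; lia
    · simp [hy, Function.comp_def]
      intro a _; lia

theorem PmV_eq_pzip (l : List ℝ) : PmV l = pzip (nz 0 l) := by
  rw [nz_eq, pzip, PmV]
  simp only [← List.map_tail, List.zip_map, List.map_map]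
  rfl

theorem pm_eq (l : List ℝ) (x : ℝ) (g o : ℕ) : pm x g l = pzip ((o, x) :: nz (o + g + 1) l) := by
  induction l generalizing x g o with
  | nil => simp [pm, nz, pzip]
  | cons y l ih =>
    rw [pm, nz]
    split_ifs with hy
    · rw [ih x (g + 1) o]; rfl
    · rw [ih y 0 (o + g + 1)]
      simp [pzip]
      congr 1; lia

theorem PmV_cons (x : ℝ) (hx : x ≠ 0) (l : List ℝ) : PmV (x :: l) = pm x 0 l := by
  rw [PmV_eq_pzip, pm_eq l x 0 0, nz, if_neg hx]

noncomputable def tm (s : ℕ → ℝ) (x : ℝ) (g : ℕ) : ℕ → ℤ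
  | 0 => 0
  | n + 1 => if s n = 0 then tm s x (g + 1) n else pterm (g + 1) x (s n) + tm s (s n) 0 n

theorem pm_ofFn (s : ℕ → ℝ) (n : ℕ) (x : ℝ) (g : ℕ) :
    pm x g (List.ofFn fun i : Fin n => s (n - 1 - i)) = tm s x g n := by
  induction n generalizing x g with
  | zero => simp [pm, tm]
  | succ n ih =>
    rw [List.ofFn_succ, pm, tm]
    have : (fun i : Fin n => s (n + 1 - 1 - (i.succ : ℕ))) = fun i : Fin n => s (n - 1 - i) := by
      ext i; congr 1; simp; lia
    rw [this, ih, ih]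
    simp

theorem PmV_ofFn (s : ℕ → ℝ) (n : ℕ) (h : s n ≠ 0) :
    PmV (List.ofFn fun i : Fin (n + 1) => s (n - i)) = tm s (s n) 0 n := by
  rw [List.ofFn_succ, PmV_cons _ (by simpa using h)]
  have : (fun i : Fin n => s (n - (i.succ : ℕ))) = fun i : Fin n => s (n - 1 - i) := by
    ext i; congr 1; simp; lia
  rw [this, pm_ofFn]
  simp

theorem tm_zeros (s : ℕ → ℝ) (x : ℝ) (g n k : ℕ) (h : ∀ j, n ≤ j → j < n + k → s j = 0) :
    tm s x g (n + k) = tm s x (g + k) n := by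
  induction k generalizing g with
  | zero => rfl
  | succ k ih =>
    rw [← add_assoc, tm, if_pos (h _ (by lia) (by lia)), ih _ fun j h1 h2 => h j h1 (by lia)]
    congr 1; lia

/-- Skip zeros down to the next nonzero entry. -/
theorem tm_next (s : ℕ → ℝ) (x : ℝ) (p q : ℕ) (hqp : q < p) (hq : s q ≠ 0)
    (h : ∀ j, q < j → j < p → s j = 0) :
    tm s x 0 p = pterm (p - q) x (s q) + tm s (s q) 0 q := by
  obtain ⟨k, rfl⟩ := Nat.exists_eq_add_of_lt hqp
  rw [show q + k + 1 = (q + 1) + k by lia, tm_zeros s x 0 (q + 1) k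
    (fun j h1 h2 => h j (by lia) (by lia)), tm, if_neg hq]
  congr 2; lia

theorem tm_all_zero (s : ℕ → ℝ) (x : ℝ) (g n : ℕ) (h : ∀ j, j < n → s j = 0) :
    tm s x g n = 0 := by
  have := tm_zeros s x g 0 n (fun j _ hj => h j (by simpa using hj))
  rw [zero_add] at this
  rw [this]; rfl

theorem pterm_scale (g : ℕ) (x y c : ℝ) (hc : c ≠ 0) : pterm g (c * x) (c * y) = pterm g x y := by
  have : 0 < c * x * (c * y) ↔ 0 < x * y := by
    rw [show c * x * (c * y) = (c * c) * (x * y) by ring]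
    exact mul_pos_iff_of_pos_left (mul_self_pos.2 hc)
  simp [pterm, this]

theorem tm_scale (s t : ℕ → ℝ) (x c : ℝ) (hc : c ≠ 0) (g n : ℕ) (h : ∀ j, j < n → t j = c * s j) :
    tm t (c * x) g n = tm s x g n := by
  induction n generalizing x g with
  | zero => rfl
  | succ n ih =>
    have ih' := fun x g => ih x g (fun j hj => h j (by lia))
    rw [tm, tm, h n (by lia), ih', ih', pterm_scale _ _ _ _ hc]
    simp [hc]

noncomputable def sE (m n j : ℕ) (P Q : ℝ[X]) (i c : ℕ) : ℝ :=
  (if i < n then X ^ (n - 1 - i) * P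
    else X ^ (m - 1 - (i - n)) * Q).coeff (m + n + j - 1 - c)

noncomputable def sM (m n j : ℕ) (P Q : ℝ[X]) : Matrix (Fin (m + n)) (Fin (m + n)) ℝ :=
  Matrix.of fun i c => sE m n j P Q i c

noncomputable def sD (m n j : ℕ) (P Q : ℝ[X]) : ℝ := (sM m n j P Q).det

theorem syHa_det (p q j : ℕ) (P Q : ℝ[X]) (hp : j < p) (hq : j ≤ q) :
    (syHaMatrix p q j j P Q).det = sD (p - j) (q - j) j P Q := by
  rw [sD, ← Matrix.det_submatrix_equiv_self
    (finCongr (by lia : (p - j) + (q - j) = p + q - 2 * j))]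
  congr 1
  ext i c
  simp only [syHaMatrix, sM, sE, Matrix.of_apply, Matrix.submatrix_apply, finCongr_apply, Fin.val_cast]
  congr 1
  have := c.2
  split_ifs <;> lia

theorem sD_drop (m n j : ℕ) (P Q : ℝ[X]) (hP : P.natDegree ≤ m + j) (hQ : Q.natDegree ≤ n + j) :
    sD m (n + 1) j P Q = P.coeff (m + j) * sD m n j P Q := by
  have h := Matrix.det_succ_column_zero (n := m + n) (sM m (n + 1) j P Q)
  rw [sD]
  refine h.trans ?_
  rw [Finset.sum_eq_single 0]
  · have e1 : sM m (n + 1) j P Q (0 : Fin (m + n + 1)) (0 : Fin (m + n + 1)) = P.coeff (m + j) := by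
      change sE m (n + 1) j P Q 0 0 = _
      rw [sE, if_pos (by lia), coeff_X_pow_mul', if_pos (by lia)]
      congr 1; lia
    rw [e1, sD]
    simp only [Fin.val_zero, pow_zero, one_mul]
    congr 2
    ext i c
    rw [Matrix.submatrix_apply, Fin.zero_succAbove]
    change sE m (n + 1) j P Q ((i : ℕ) + 1) ((c : ℕ) + 1) = sE m n j P Q i c
    simp only [sE]
    have e : m + (n + 1) + j - 1 - (c + 1 : ℕ) = m + n + j - 1 - c := by lia
    rw [e]
    by_cases hi : (i : ℕ) < n
    · rw [if_pos hi, if_pos (by lia)]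
      congr 3; lia
    · rw [if_neg hi, if_neg (by lia)]
      congr 3; lia
  · intro i _ hi
    have hi0 : (i : ℕ) ≠ 0 := fun h => hi (Fin.ext h)
    have hi2 := i.2
    have : sM m (n + 1) j P Q i (0 : Fin (m + n + 1)) = 0 := by
      change sE m (n + 1) j P Q i 0 = 0
      rw [sE]
      split_ifs with h1
      · rw [coeff_X_pow_mul', if_pos (by lia)]
        exact coeff_eq_zero_of_natDegree_lt (by lia)
      · rw [coeff_X_pow_mul', if_pos (by lia)]
        exact coeff_eq_zero_of_natDegree_lt (by lia)
    rw [this]; ring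
  · simp

theorem sD_drops (m n k j : ℕ) (P Q : ℝ[X]) (hP : P.natDegree ≤ m + j)
    (hQ : Q.natDegree ≤ n + j) :
    sD m (n + k) j P Q = P.coeff (m + j) ^ k * sD m n j P Q := by
  induction k with
  | zero => simp
  | succ k ih => rw [← add_assoc, sD_drop _ _ _ _ _ hP (by lia), ih]; ring

theorem det_swap_blocks (m n : ℕ) (M : Matrix (Fin (n + m)) (Fin (n + m)) ℝ) :
    (M.reindex (finCongr (add_comm n m))
      (finSumFinEquiv.symm.trans <| (Equiv.sumComm _ _).trans finSumFinEquiv)).det =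
      (-1) ^ (m * n) * M.det := by
  rw [Matrix.det_reindex, Equiv.Perm.sign_eq_prod_prod_Ioi]
  congr 1
  dsimp
  simp only [Units.coe_prod, Int.cast_prod]
  simp_rw [← finSumFinEquiv.prod_comp, ← Finset.prod_map_equiv finSumFinEquiv.symm]
  simp only [Equiv.symm_apply_apply, ← Fin.val_fin_lt, Equiv.symm_symm, Function.comp_apply,
    ← Finset.prod_ite_mem_eq (Finset.map _ _), Finset.mem_map_equiv, Finset.mem_Ioi,
    Fintype.prod_sum_type, finSumFinEquiv_apply_left, Fin.val_castAdd,
    finSumFinEquiv_apply_right, Fin.val_natAdd, add_lt_add_iff_left]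
  simp [(Fin.isLt _).trans_le, pow_mul]
  have h1 : ∀ (k : ℕ) (x y : Fin k),
      (if x < y then (((if x < y then (1 : ℤˣ) else -1 : ℤˣ) : ℤ) : ℝ) else 1) = 1 := by
    intro k x y
    split_ifs <;> simp
  have h2 : ∀ (x : Fin n) (y : Fin m),
      (((if (x : ℕ) + m < (y : ℕ) then (1 : ℤˣ) else -1 : ℤˣ) : ℤ) : ℝ) = -1 := by
    intro x y
    rw [if_neg (by lia)]; simp
  simp [h1, h2]

theorem sD_swap (m n j : ℕ) (P Q : ℝ[X]) : sD m n j P Q = (-1) ^ (m * n) * sD n m j Q P := by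
  have hA : sD m n j P Q = (Matrix.of fun i c : Fin (n + m) => sE m n j P Q c i).det := by
    rw [← Matrix.det_transpose, sD,
      ← Matrix.det_submatrix_equiv_self (finCongr (add_comm n m))]
    rfl
  have hB : sD n m j Q P = (Matrix.of fun i c : Fin (m + n) => sE n m j Q P c i).det := by
    rw [← Matrix.det_transpose, sD,
      ← Matrix.det_submatrix_equiv_self (finCongr (add_comm m n))]
    rfl
  rw [hA, hB, mul_comm m n, ← det_swap_blocks]
  congr 1
  ext i c
  induction c using Fin.addCases with
  | left c =>
    simp [sE, add_comm n m]
  | right c =>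
    simp [sE, add_comm n m]

theorem sD_rowop (m n j : ℕ) (P Q D : ℝ[X]) (h : D.natDegree + n ≤ m) :
    sD m n j (D * Q + P) Q = sD m n j P Q := by
  let N : Matrix (Fin (m + n)) (Fin (m + n)) ℝ := Matrix.of fun i k =>
    if (i : ℕ) < n ∧ n ≤ (k : ℕ) then (X ^ (n - 1 - (i : ℕ)) * D).coeff (m - 1 - ((k : ℕ) - n)) else 0
  have hdet : (1 + N).det = 1 := by
    rw [Matrix.det_of_isUpperTriangular]
    · apply Finset.prod_eq_one
      intro i _
      simp [N]
    · intro i k hik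
      have : (k : ℕ) < i := hik
      simp only [Matrix.add_apply, N, Matrix.of_apply]
      rw [Matrix.one_apply_ne (by intro h; rw [h] at this; lia), if_neg (by lia), zero_add]
  have hmul : sM m n j (D * Q + P) Q = (1 + N) * sM m n j P Q := by
    rw [add_mul, one_mul]
    ext i c
    rw [Matrix.add_apply, Matrix.mul_apply]
    set e := m + n + j - 1 - (c : ℕ) with he
    have hsum : ∑ k, N i k * sM m n j P Q k c = ∑ k ∈ Finset.range (n + m),
        (if (i : ℕ) < n ∧ n ≤ k then (X ^ (n - 1 - (i : ℕ)) * D).coeff (m - 1 - (k - n)) else 0) *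
        (if k < n then X ^ (n - 1 - k) * P else X ^ (m - 1 - (k - n)) * Q).coeff e := by
      rw [add_comm n m, Finset.sum_range]
      rfl
    rw [hsum, Finset.sum_range_add]
    rw [Finset.sum_eq_zero (s := Finset.range n), zero_add]
    swap
    · intro k hk
      rw [Finset.mem_range] at hk
      rw [if_neg (by lia), zero_mul]
    simp only [sM, sE, Matrix.of_apply, ← he]
    by_cases hi : (i : ℕ) < n
    · simp only [hi, true_and, if_true, le_add_iff_nonneg_right, zero_le, add_tsub_cancel_left,
        Nat.not_lt.2 (Nat.le_add_right n _), if_false]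
      have hrefl := Finset.sum_range_reflect (fun k => (X ^ (n - 1 - (i : ℕ)) * D).coeff k * (X ^ k * Q).coeff e) m
      rw [hrefl]
      have hD : (X ^ (n - 1 - (i : ℕ)) * D).natDegree < m := by
        refine lt_of_le_of_lt natDegree_mul_le ?_
        rw [natDegree_X_pow]; lia
      have := as_sum_range_C_mul_X_pow' (X ^ (n - 1 - (i : ℕ)) * D) hD
      rw [show X ^ (n - 1 - (i : ℕ)) * (D * Q + P) = X ^ (n - 1 - (i : ℕ)) * P + X ^ (n - 1 - (i : ℕ)) * D * Q by ring]
      conv_lhs => rw [this]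
      rw [coeff_add, Finset.sum_mul, finsetSum_coeff]
      simp only [mul_assoc, coeff_C_mul]
    · simp [hi]
  rw [sD, hmul, Matrix.det_mul, hdet, one_mul, sD]

theorem sD_neg (m n j : ℕ) (P Q : ℝ[X]) : sD m n j (-P) Q = (-1) ^ n * sD m n j P Q := by
  have : sM m n j (-P) Q = Matrix.of fun i c =>
      (fun i : Fin (m + n) => if (i : ℕ) < n then (-1 : ℝ) else 1) i * sM m n j P Q i c := by
    ext i c
    simp only [sM, sE, Matrix.of_apply]
    split_ifs <;> simp
  rw [sD, this, Matrix.det_mul_column, sD]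
  congr 1
  rw [← Finset.prod_range (fun i => if i < n then (-1 : ℝ) else 1), add_comm, Finset.prod_range_add]
  rw [Finset.prod_congr rfl (g := fun _ => (-1 : ℝ)) (by intro x hx; rw [if_pos (Finset.mem_range.1 hx)])]
  simp

theorem sD_last (n j : ℕ) (hn : 0 < n) (P Q : ℝ[X]) (hQ : ∀ i, j ≤ i → Q.coeff i = 0) :
    sD n 0 j P Q = 0 := by
  apply Matrix.det_eq_zero_of_row_eq_zero (⟨n - 1, by lia⟩ : Fin (n + 0))
  intro c
  have := c.2
  simp only [sM, sE, Matrix.of_apply, Nat.not_lt_zero, if_false]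
  rw [coeff_X_pow_mul', if_pos (by lia)]
  exact hQ _ (by lia)

theorem sD_diag (m j : ℕ) (P Q : ℝ[X]) (hQ : Q.natDegree ≤ j) :
    sD m 0 j P Q = Q.coeff j ^ m := by
  have : sD m 0 j P Q = sD m 0 j 0 Q := by
    rw [sD, sD]; congr 1
  have h2 := sD_drops 0 0 m j Q 0 (by simpa using hQ) (by simp)
  rw [this, sD_swap, mul_zero, pow_zero, one_mul]
  rw [zero_add] at h2
  rw [h2, zero_add, sD]
  have : (sM 0 0 j Q 0).det = 1 := Matrix.det_fin_zero
  rw [this, mul_one]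

theorem tri_succ (k : ℕ) : (k + 1) * (k + 1 - 1) / 2 = k * (k - 1) / 2 + k := by
  have := Nat.triangle_succ k
  simpa using this

theorem tri_add (n d : ℕ) :
    (n + d) * (n + d - 1) / 2 = n * (n - 1) / 2 + d * (d - 1) / 2 + n * d := by
  induction d with
  | zero => simp
  | succ d ih => rw [← add_assoc, tri_succ, tri_succ, ih]; ring

theorem sign_id (m n : ℕ) (h : n ≤ m) :
    (-1 : ℝ) ^ (m * (m - 1) / 2) * ((-1) ^ n * (-1) ^ (m * n)) =
      (-1) ^ ((m - n) * (m - n - 1) / 2) * (-1) ^ (n * (n - 1) / 2) := by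
  obtain ⟨d, rfl⟩ := Nat.exists_eq_add_of_le h
  rw [tri_add, Nat.add_sub_cancel_left, ← pow_add, ← pow_add, ← pow_add]
  obtain ⟨k, hk⟩ := Nat.even_mul_succ_self n
  rw [show n * (n - 1) / 2 + d * (d - 1) / 2 + n * d + (n + (n + d) * n) =
    (d * (d - 1) / 2 + n * (n - 1) / 2) + 2 * (n * d) + n * (n + 1) by ring, hk, ← two_mul,
    pow_add, pow_add, pow_mul, pow_mul]
  simp

noncomputable def srSeq (p q : ℕ) (P Q : ℝ[X]) (j : ℕ) : ℝ :=
  if q < j then 0 else (-1) ^ ((p - j) * (p - j - 1) / 2) * sD (p - j) (q - j) j P Q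

theorem srSeq_top (p q : ℕ) (P Q : ℝ[X]) (hQ : Q.natDegree ≤ q) :
    srSeq p q P Q q = (-1) ^ ((p - q) * (p - q - 1) / 2) * Q.coeff q ^ (p - q) := by
  rw [srSeq, if_neg (lt_irrefl q), Nat.sub_self, sD_diag _ _ _ _ hQ]

theorem sD_reduce (p q j : ℕ) (P Q D R : ℝ[X]) (hj : j < q) (hD : D.natDegree + q ≤ p)
    (h : P = D * Q + R) :
    sD (p - j) (q - j) j P Q =
      (-1) ^ (q - j) * (-1) ^ ((p - j) * (q - j)) * sD (q - j) (p - j) j Q (-R) := by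
  rw [h, sD_rowop _ _ _ _ _ _ (by lia)]
  conv_lhs => rw [← neg_neg R]
  rw [sD_neg, sD_swap (p - j), mul_assoc]

theorem srSeq_step (p q r j : ℕ) (P Q D R : ℝ[X]) (hqp : q < p) (hrq : r < q) (hj : j ≤ r)
    (hD : D.natDegree + q ≤ p) (h : P = D * Q + R) (hQ : Q.natDegree ≤ q)
    (hR : R.natDegree ≤ r) :
    srSeq p q P Q j = (-1) ^ ((p - q) * (p - q - 1) / 2) * Q.coeff q ^ (p - r) * srSeq q r Q (-R) j := by
  rw [srSeq, srSeq, if_neg (by lia), if_neg (by lia), sD_reduce p q j P Q D R (by lia) hD h]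
  have h1 := sD_drops (q - j) (r - j) (p - r) j Q (-R) (by lia) (by rw [natDegree_neg]; lia)
  rw [show r - j + (p - r) = p - j by lia, show q - j + j = q by lia] at h1
  rw [h1]
  have h2 := sign_id (p - j) (q - j) (by lia)
  rw [show p - j - (q - j) = p - q by lia] at h2
  linear_combination (Q.coeff q ^ (p - r) * sD (q - j) (r - j) j Q (-R)) * h2

theorem srSeq_zero (p q j : ℕ) (P Q D R : ℝ[X]) (hj : j < q) (hD : D.natDegree + q ≤ p)
    (h : P = D * Q + R) (hQ : Q.natDegree ≤ q) (hR : ∀ i, j ≤ i → R.coeff i = 0) :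
    srSeq p q P Q j = 0 := by
  rw [srSeq, if_neg (by lia), sD_reduce p q j P Q D R (by lia) hD h]
  have h0 : (-R).natDegree ≤ 0 + j := by
    rw [natDegree_neg, zero_add, natDegree_le_iff_coeff_eq_zero]
    intro i hi
    exact hR i hi.le
  have h1 := sD_drops (q - j) 0 (p - j) j Q (-R) (by lia) h0
  rw [zero_add] at h1
  rw [h1, sD_last (q - j) j (by lia) Q (-R) (by intro i hi; simp [hR i hi])]
  simp

theorem pterm_head (d : ℕ) (a b : ℝ) (ha : a ≠ 0) (hb : b ≠ 0) :
    pterm d a ((-1) ^ (d * (d - 1) / 2) * b ^ d) =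
      if Odd d then (SignType.sign (a * b) : ℤ) else 0 := by
  rw [pterm]
  by_cases hd : Odd d
  · obtain ⟨k, rfl⟩ := hd
    have ho : Odd (2 * k + 1) := ⟨k, rfl⟩
    rw [if_pos (by lia : (2 * k + 1) % 2 = 1), if_pos ho]
    have e1 : (2 * k + 1) * (2 * k + 1 - 1) / 2 = 2 * (k * k) + k := by
      rw [Nat.add_sub_cancel, show (2 * k + 1) * (2 * k) = (2 * (k * k) + k) * 2 by ring]
      simp
    have e2 : (2 * k + 1 - 1) / 2 = k := by lia
    have hpos : 0 < (b ^ k) ^ 2 := by positivity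
    rw [e1, e2, pow_add, pow_mul]
    have hab : a * b ≠ 0 := mul_ne_zero ha hb
    rcases Nat.even_or_odd k with hk | hk
    · have e3 : a * (((-1) ^ 2) ^ (k * k) * (-1) ^ k * b ^ (2 * k + 1)) = (b ^ k) ^ 2 * (a * b) := by
        rw [hk.neg_one_pow]; simp; ring
      rw [e3, hk.neg_one_pow]
      simp only [mul_pos_iff_of_pos_left hpos]
      rcases lt_or_gt_of_ne hab with h | h
      · rw [if_neg h.not_gt, sign_neg h]; simp
      · rw [if_pos h, sign_pos h]; simp
    · have e3 : a * (((-1) ^ 2) ^ (k * k) * (-1) ^ k * b ^ (2 * k + 1)) =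
          (b ^ k) ^ 2 * (-(a * b)) := by
        rw [hk.neg_one_pow]; simp; ring
      rw [e3, hk.neg_one_pow]
      simp only [mul_pos_iff_of_pos_left hpos, neg_pos]
      rcases lt_or_gt_of_ne hab with h | h
      · rw [if_pos h, sign_neg h]; simp
      · rw [if_neg h.not_gt, sign_pos h]; simp
  · rw [if_neg hd, if_neg (by rwa [Nat.odd_iff] at hd)]

theorem pterm_second (p q r : ℕ) (e b y : ℝ) (he : e ≠ 0) (hb : b ≠ 0) (hqp : q < p) (hrq : r < q) :
    pterm (q - r) (e * b ^ (p - q)) (e * b ^ (p - r) * y) = pterm (q - r) b y := by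
  by_cases ho : (q - r) % 2 = 1
  · obtain ⟨k, hk⟩ : ∃ k, (p - q) + (p - r) = 2 * k + 1 := ⟨((p - q) + (p - r)) / 2, by lia⟩
    have : 0 < e * b ^ (p - q) * (e * b ^ (p - r) * y) ↔ 0 < b * y := by
      rw [show e * b ^ (p - q) * (e * b ^ (p - r) * y) = e ^ 2 * b ^ ((p - q) + (p - r)) * y by
        rw [pow_add]; ring, hk,
        show e ^ 2 * b ^ (2 * k + 1) * y = (e * b ^ k) ^ 2 * (b * y) by ring]
      exact mul_pos_iff_of_pos_left (by positivity)
    simp [pterm, this]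
  · simp [pterm, ho]

theorem tm_sq_eq_cInd (q : ℕ) : ∀ (p : ℕ) (P Q : ℝ[X]), P.natDegree = p → Q.natDegree = q →
    q < p → Q ≠ 0 → tm (srSeq p q P Q) P.leadingCoeff 0 p = cInd Q P := by
  induction q using Nat.strong_induction_on with
  | _ q ih =>
  intro p P Q hP hQ hqp hQ0
  have hP0 : P ≠ 0 := by rintro rfl; simp at hP; lia
  have hb : Q.leadingCoeff ≠ 0 := leadingCoeff_ne_zero.2 hQ0
  have hbq : Q.coeff q = Q.leadingCoeff := by rw [← hQ]; rfl
  set e : ℝ := (-1) ^ ((p - q) * (p - q - 1) / 2) with he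
  have he0 : e ≠ 0 := pow_ne_zero _ (by norm_num)
  have hsq : srSeq p q P Q q = e * Q.leadingCoeff ^ (p - q) := by rw [srSeq_top p q P Q hQ.le, hbq]
  have hsq0 : srSeq p q P Q q ≠ 0 := by rw [hsq]; exact mul_ne_zero he0 (pow_ne_zero _ hb)
  rw [tm_next _ _ p q hqp hsq0 (by intro j h1 h2; rw [srSeq, if_pos h1])]
  have hdm : P = (P / Q) * Q + P % Q := by
    rw [mul_comm]; exact (EuclideanDomain.div_add_mod P Q).symm
  have hdeg : (P % Q).degree < Q.degree := EuclideanDomain.mod_lt P hQ0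
  set D := P / Q
  set R := P % Q
  have hRle : R.natDegree ≤ q := by rw [← hQ]; exact natDegree_le_natDegree hdeg.le
  have hD : D.natDegree + q ≤ p := by
    by_cases hD0 : D = 0
    · rw [hD0]; simp; lia
    · rw [← hQ, ← natDegree_mul hD0 hQ0, show D * Q = P - R by rw [hdm]; ring]
      exact (natDegree_sub_le _ _).trans (by simp; lia)
  have hhead : pterm (p - q) P.leadingCoeff (srSeq p q P Q q) = halfSum (P * Q) := by
    rw [hsq, pterm_head _ _ _ (leadingCoeff_ne_zero.2 hP0) hb, halfSum_eq _ (mul_ne_zero hP0 hQ0),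
      natDegree_mul hP0 hQ0, hP, hQ, leadingCoeff_mul]
    have : Odd (p - q) ↔ Odd (p + q) := by
      simp only [Nat.odd_iff]; lia
    simp [this]
  have hind : cInd Q P = halfSum (P * Q) + cInd (-R) Q := by
    rw [← cInd_add P Q hP0 hQ0, cInd_mod P Q D R hQ0 hdm]; ring
  rw [hhead, hind]
  congr 1
  by_cases hR : R = 0
  · rw [tm_all_zero _ _ _ _ (fun j hj => srSeq_zero p q j P Q D R hj hD hdm hQ.le (by simp [hR]))]
    simp [hR, cInd, jump_zero]
  set r := R.natDegree with hr
  have hrq : r < q := by rw [← hQ]; exact natDegree_lt_natDegree hR hdeg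
  have hnR : -R ≠ 0 := neg_ne_zero.2 hR
  rw [← ih r hrq q Q (-R) hQ (natDegree_neg R) hrq hnR]
  have hstep : ∀ j, j ≤ r → srSeq p q P Q j = e * Q.leadingCoeff ^ (p - r) * srSeq q r Q (-R) j := by
    intro j hj
    rw [srSeq_step p q r j P Q D R hqp hrq hj hD hdm hQ.le le_rfl, hbq]
  have hc0 : e * Q.leadingCoeff ^ (p - r) ≠ 0 := mul_ne_zero he0 (pow_ne_zero _ hb)
  have hs' : srSeq q r Q (-R) r ≠ 0 := by
    rw [srSeq_top q r Q (-R) (natDegree_neg R).le]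
    refine mul_ne_zero (pow_ne_zero _ (by norm_num)) (pow_ne_zero _ ?_)
    rw [coeff_neg, neg_ne_zero]
    exact leadingCoeff_ne_zero.2 hR
  have hs : srSeq p q P Q r ≠ 0 := by rw [hstep r le_rfl]; exact mul_ne_zero hc0 hs'
  rw [tm_next (srSeq q r Q (-R)) _ q r hrq hs' (by intro j h1 h2; rw [srSeq, if_pos h1]),
    tm_next (srSeq p q P Q) _ q r hrq hs (fun j h1 h2 => srSeq_zero p q j P Q D R h2 hD hdm hQ.le
      (fun i hi => coeff_eq_zero_of_natDegree_lt (by lia))), hsq, hstep r le_rfl,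
    pterm_second p q r e _ _ he0 hb hqp hrq,
    tm_scale (srSeq q r Q (-R)) (srSeq p q P Q) _ _ hc0 0 r (fun j hj => hstep j hj.le)]

theorem signedSubres_coeff (p q j : ℕ) (P Q : ℝ[X]) (hj : j < p) (hq : j ≤ q) :
    (signedSubres p q j P Q).coeff j = srSeq p q P Q j := by
  rw [signedSubres, if_neg hj.ne, srSeq, if_neg (by lia), ← syHa_det p q j P Q hj hq,
    show (-1 : ℝ[X]) = C (-1) by simp, ← C_pow, coeff_C_mul, finsetSum_coeff]
  congr 1
  simp [coeff_X_pow]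

theorem tm_congr (s t : ℕ → ℝ) (x : ℝ) (g n : ℕ) (h : ∀ j, j < n → t j = s j) :
    tm t x g n = tm s x g n := by
  have := tm_scale s t x 1 one_ne_zero g n (by simpa using h)
  rwa [one_mul] at this

/-- **Counting real roots via the Sturm–Habicht sequence** (González-Vega–Lombardi–Recio–Roy):
for a nonconstant `P ∈ ℝ[T]`, the number of distinct real roots of `P` equals the
generalized sign-change count `PmV` of the sequence of principal coefficients
`sr_p, …, sr_0` of the signed subresultant sequence `sres(P, P')`, where `p = deg P` and
`sr_j` is the coefficient of `T^j` in the `j`-th signed subresultant. -/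
theorem card_real_roots_eq_PmV_sturm_habicht
    (P : Polynomial ℝ) (hP : 1 ≤ P.natDegree) :
    (P.roots.toFinset.card : ℤ) =
      PmV (List.ofFn fun i : Fin (P.natDegree + 1) =>
        (signedSubres P.natDegree (P.natDegree - 1) (P.natDegree - (i : ℕ))
            P (Polynomial.derivative P)).coeff (P.natDegree - (i : ℕ))) := by

  set p := P.natDegree with hp
  have hP0 : P ≠ 0 := by rintro rfl; simp at hp; lia
  have hd : (derivative P).natDegree = p - 1 := natDegree_derivative P
  have hd0 : derivative P ≠ 0 := by
    intro h
    have := derivative_eq_zero.1 h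
    lia
  have htop : (signedSubres p (p - 1) p P (derivative P)).coeff p = P.leadingCoeff := by
    rw [signedSubres, if_pos rfl]; rfl
  rw [PmV_ofFn (fun j => (signedSubres p (p - 1) j P (derivative P)).coeff j) p
    (by simp only [htop]; exact leadingCoeff_ne_zero.2 hP0)]
  simp only [htop]
  rw [tm_congr (srSeq p (p - 1) P (derivative P)) _ _ _ _
    (fun j hj => signedSubres_coeff p (p - 1) j P _ hj (by lia)),
    tm_sq_eq_cInd (p - 1) p P (derivative P) hp.symm hd (by lia) hd0, cInd_derivative P hP0]
end
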